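/- arXiv:2011.09441 — 3 statements merged into one kernel-verified Lean document; each statement's English description precedes it below -/
import Mathlib

section
/- There exists a universal constant C > 0 such that for every dimension d ≥ 1 and every function f : {0,1}^d → ℝ, the expectation over a uniformly random x ∈ {0,1}^d of sqrt(I_f^-(x)) is at least C · ε(f); that is, (1/2^d) · Σ_{x ∈ {0,1}^d} sqrt(I_f^-(x)) ≥ C · ε(f). -/
/-- A directed hypercube edge: `y` is obtained from `x` by flipping one coordinate
from `false` to `true`. -/
def IsEdge {d : ℕ} (x y : Fin d → Bool) : Prop :=
  ∃ i : Fin d, x i = false ∧ y i = true ∧ ∀ j : Fin d, j ≠ i → x j = y j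

/-- A function on the hypercube is monotone if it respects the coordinatewise order. -/
def MonotoneCube {d : ℕ} (g : (Fin d → Bool) → ℝ) : Prop :=
  ∀ x y : Fin d → Bool, (∀ i, x i ≤ y i) → g x ≤ g y

/-- Distance to monotonicity: the minimum fraction of points on which `f` must be
changed to obtain a monotone function. -/
noncomputable def distMono (d : ℕ) (f : (Fin d → Bool) → ℝ) : ℝ :=
  ((sInf {n : ℕ | ∃ g : (Fin d → Bool) → ℝ, MonotoneCube g ∧
      n = Nat.card {x : Fin d → Bool // f x ≠ g x}} : ℕ) : ℝ) / 2 ^ d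

/-- `I_f^-(x)`: the number of outgoing violated edges at `x`. -/
noncomputable def outViol (d : ℕ) (f : (Fin d → Bool) → ℝ) (x : Fin d → Bool) : ℕ :=
  Nat.card {y : Fin d → Bool // IsEdge x y ∧ f x > f y}

/-- Flip the `i`-th coordinate of a point of the hypercube. -/
def flipAt {ι : Type*} [DecidableEq ι] (i : ι) (x : ι → Bool) : ι → Bool :=
  Function.update x i (!x i)

section Flip

variable {ι : Type*} [DecidableEq ι]

@[simp] theorem flipAt_same (i : ι) (x : ι → Bool) : flipAt i x i = !x i := by
  simp [flipAt]

theorem flipAt_of_ne {i j : ι} (h : j ≠ i) (x : ι → Bool) : flipAt i x j = x j := by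
  simp [flipAt, h]

@[simp] theorem flipAt_flipAt (i : ι) (x : ι → Bool) : flipAt i (flipAt i x) = x := by
  ext j; by_cases h : j = i
  · subst h; simp
  · simp [flipAt_of_ne h]

theorem flipAt_comm (i j : ι) (x : ι → Bool) :
    flipAt i (flipAt j x) = flipAt j (flipAt i x) := by
  by_cases hij : i = j
  · rw [hij]
  ext k
  by_cases hi : k = i
  · subst hi; simp [flipAt_of_ne hij]
  · by_cases hj : k = j
    · subst hj; simp [flipAt_of_ne hi]
    · simp [flipAt_of_ne hi, flipAt_of_ne hj]

/-- Flipping a coordinate as a permutation of the hypercube. -/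
def flipEquiv (i : ι) : Equiv.Perm (ι → Bool) :=
  ⟨flipAt i, flipAt i, flipAt_flipAt i, flipAt_flipAt i⟩

theorem sum_flipAt [Fintype ι] {M : Type*} [AddCommMonoid M] (i : ι) (F : (ι → Bool) → M) :
    ∑ x, F (flipAt i x) = ∑ x, F x :=
  Equiv.sum_comp (flipEquiv i) F

/-- A pairwise inequality along the edges of one direction can be summed. -/
theorem sum_le_sum_of_flip [Fintype ι] (i : ι) (F G : (ι → Bool) → ℝ)
    (h : ∀ x, F x + F (flipAt i x) ≤ G x + G (flipAt i x)) : ∑ x, F x ≤ ∑ x, G x := by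
  have := Finset.sum_le_sum fun x (_ : x ∈ Finset.univ) => h x
  rw [Finset.sum_add_distrib, Finset.sum_add_distrib, sum_flipAt, sum_flipAt] at this
  linarith

end Flip

section Talagrand

/-- The `i`-th coordinate of a point of the hypercube as a sign. -/
def coordSign {ι : Type*} (i : ι) (x : ι → Bool) : ℝ := if x i then 1 else -1

variable {ι : Type*}

theorem coordSign_mul_self (i : ι) (x : ι → Bool) : coordSign i x * coordSign i x = 1 := by
  cases h : x i <;> simp [coordSign, h]

theorem abs_coordSign (i : ι) (x : ι → Bool) : |coordSign i x| = 1 := by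
  cases h : x i <;> simp [coordSign, h]

variable [DecidableEq ι]

theorem coordSign_flipAt_same (i : ι) (x : ι → Bool) :
    coordSign i (flipAt i x) = -coordSign i x := by
  cases h : x i <;> simp [coordSign, h]

theorem coordSign_flipAt_of_ne {i j : ι} (h : j ≠ i) (x : ι → Bool) :
    coordSign j (flipAt i x) = coordSign j x := by
  simp [coordSign, flipAt_of_ne h]

variable [Fintype ι]

theorem sum_coordSign_mul (i j : ι) :
    ∑ x : ι → Bool, coordSign i x * coordSign j x =
      if i = j then 2 ^ Fintype.card ι else 0 := by
  split_ifs with h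
  · subst h; simp [coordSign_mul_self]
  · have h1 := sum_flipAt i fun x : ι → Bool => coordSign i x * coordSign j x
    simp only [coordSign_flipAt_same, coordSign_flipAt_of_ne (Ne.symm h), neg_mul,
      Finset.sum_neg_distrib] at h1
    linarith

/-- Bessel's inequality for the coordinate functions. -/
theorem sum_sq_sum_coordSign_mul_le (g : (ι → Bool) → ℝ) :
    ∑ i, (∑ x, coordSign i x * g x) ^ 2 ≤ 2 ^ Fintype.card ι * ∑ x, g x ^ 2 := by
  set S : ι → ℝ := fun i => ∑ x, coordSign i x * g x with hS
  set N : ℝ := 2 ^ Fintype.card ι with hN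
  have hNpos : 0 < N := by positivity
  have h1 : ∑ x, (N * g x - ∑ i, S i * coordSign i x) ^ 2
      = N * (N * ∑ x, g x ^ 2 - ∑ i, S i ^ 2) := by
    have e1 : ∑ x, g x * ∑ i, S i * coordSign i x = ∑ i, S i ^ 2 := by
      simp_rw [Finset.mul_sum]
      rw [Finset.sum_comm]
      refine Finset.sum_congr rfl fun i _ => ?_
      rw [sq]; nth_rewrite 3 [hS]
      simp only [Finset.mul_sum]
      exact Finset.sum_congr rfl fun x _ => by ring
    have e2 : ∑ x, (∑ i, S i * coordSign i x) ^ 2 = N * ∑ i, S i ^ 2 := by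
      have : ∀ x, (∑ i, S i * coordSign i x) ^ 2
          = ∑ i, ∑ j, S i * S j * (coordSign i x * coordSign j x) := by
        intro x
        rw [sq, Finset.sum_mul_sum]
        exact Finset.sum_congr rfl fun i _ => Finset.sum_congr rfl fun j _ => by ring
      simp_rw [this]
      rw [Finset.sum_comm, Finset.mul_sum]
      refine Finset.sum_congr rfl fun i _ => ?_
      rw [Finset.sum_comm]
      simp_rw [← Finset.mul_sum, sum_coordSign_mul]
      simp
      ring
    have : ∀ x, (N * g x - ∑ i, S i * coordSign i x) ^ 2
        = N ^ 2 * g x ^ 2 - 2 * N * (g x * ∑ i, S i * coordSign i x)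
          + (∑ i, S i * coordSign i x) ^ 2 := fun x => by ring
    simp_rw [this]
    rw [Finset.sum_add_distrib, Finset.sum_sub_distrib, ← Finset.mul_sum, ← Finset.mul_sum, e1, e2]
    ring
  have h2 : 0 ≤ N * (N * ∑ x, g x ^ 2 - ∑ i, S i ^ 2) := by
    rw [← h1]; positivity
  have := nonneg_of_mul_nonneg_right h2 hNpos
  linarith

/-- The level-one inequality: the first-level weight is controlled by the expected length of
any charge vector covering the discrete derivatives. -/
theorem sum_sq_sum_coordSign_mul_le_sum_sqrt (g : (ι → Bool) → ℝ) (q : ι → (ι → Bool) → ℝ)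
    (hg : ∀ x, |g x| ≤ 1)
    (hq : ∀ j x, |g x - g (flipAt j x)| ≤ q j x + q j (flipAt j x)) :
    ∑ i, (∑ x, coordSign i x * g x) ^ 2 ≤
      2 ^ Fintype.card ι * ∑ x, √(∑ j, q j x ^ 2) := by
  set S : ι → ℝ := fun i => ∑ x, coordSign i x * g x with hS
  set N : ℝ := 2 ^ Fintype.card ι with hN
  have hNpos : 0 < N := by positivity
  have hSq : ∀ i, |S i| ≤ ∑ x, q i x := by
    intro i
    have h1 : 2 * S i = ∑ x, coordSign i x * (g x - g (flipAt i x)) := by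
      have h2 := sum_flipAt i fun x : ι → Bool => coordSign i x * g x
      simp only [coordSign_flipAt_same, neg_mul, Finset.sum_neg_distrib] at h2
      simp only [mul_sub, Finset.sum_sub_distrib, hS]
      linarith
    have h3 : |2 * S i| ≤ ∑ x, (q i x + q i (flipAt i x)) := by
      rw [h1]
      refine (Finset.abs_sum_le_sum_abs _ _).trans (Finset.sum_le_sum fun x _ => ?_)
      rw [abs_mul, abs_coordSign, one_mul]
      exact hq i x
    rw [Finset.sum_add_distrib, sum_flipAt, abs_mul, abs_two] at h3
    linarith
  have hW : ∑ i, S i ^ 2 ≤ N ^ 2 := by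
    refine (sum_sq_sum_coordSign_mul_le g).trans ?_
    rw [sq]
    refine mul_le_mul_of_nonneg_left ?_ hNpos.le
    calc ∑ x, g x ^ 2 ≤ ∑ _x : ι → Bool, (1 : ℝ) :=
          Finset.sum_le_sum fun x _ => by rw [← sq_abs]; exact pow_le_one₀ (abs_nonneg _) (hg x)
      _ = N := by simp [hN]
  calc ∑ i, S i ^ 2 ≤ ∑ i, |S i| * ∑ x, q i x := by
        refine Finset.sum_le_sum fun i _ => ?_
        rw [← sq_abs, sq]
        exact mul_le_mul_of_nonneg_left (hSq i) (abs_nonneg _)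
    _ = ∑ x, ∑ i, |S i| * q i x := by
        simp_rw [Finset.mul_sum]; exact Finset.sum_comm
    _ ≤ ∑ x, N * √(∑ j, q j x ^ 2) := by
        refine Finset.sum_le_sum fun x _ => ?_
        refine (Real.sum_mul_le_sqrt_mul_sqrt _ _ _).trans ?_
        refine mul_le_mul_of_nonneg_right ?_ (Real.sqrt_nonneg _)
        simp only [sq_abs]
        exact Real.sqrt_le_iff.2 ⟨hNpos.le, hW⟩
    _ = _ := by rw [Finset.mul_sum]

theorem sum_sqrt_sum_sub_le (m : ℕ) (a : Fin (m + 1) → ℝ) (ha : ∀ i, 0 ≤ a i) :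
    ∑ i, √(∑ j, a j - a i) ≤ ((m : ℝ) + 1 / 2) * √(∑ j, a j) := by
  set A := ∑ j, a j with hA
  have hA0 : 0 ≤ A := Finset.sum_nonneg fun i _ => ha i
  have h0 : ∀ i, 0 ≤ A - a i := fun i =>
    sub_nonneg.2 (Finset.single_le_sum (fun j _ => ha j) (Finset.mem_univ i))
  have h1 := Real.sum_sqrt_mul_sqrt_le (Finset.univ : Finset (Fin (m + 1)))
    (f := fun _ => 1) (g := fun i => A - a i) (fun _ => zero_le_one) h0
  simp only [Real.sqrt_one, one_mul, Finset.sum_const, Finset.card_univ, Fintype.card_fin,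
    nsmul_eq_mul, mul_one, Finset.sum_sub_distrib, ← hA] at h1
  refine h1.trans ?_
  rw [← Real.sqrt_mul (by positivity)]
  refine Real.sqrt_le_iff.2 ⟨by positivity, ?_⟩
  rw [mul_pow, Real.sq_sqrt hA0]
  push_cast
  nlinarith

theorem flipAt_insertNth {n : ℕ} (i : Fin (n + 1)) (b : Bool) (j : Fin n) (y : Fin n → Bool) :
    flipAt (i.succAbove j) (i.insertNth b y : Fin (n + 1) → Bool)
      = i.insertNth b (flipAt j y) := by
  ext k
  induction k using Fin.succAboveCases i with
  | x => simp [flipAt_of_ne (Fin.succAbove_ne i j).symm]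
  | p k =>
    by_cases h : k = j
    · subst h; simp
    · have : i.succAbove k ≠ i.succAbove j := fun e => h (Fin.succAbove_right_injective e)
      simp [flipAt_of_ne this, flipAt_of_ne h]

theorem sum_eq_sum_insertNth {n : ℕ} (i : Fin (n + 1)) (F : (Fin (n + 1) → Bool) → ℝ) :
    ∑ x, F x = ∑ y : Fin n → Bool, F (i.insertNth false y) +
      ∑ y : Fin n → Bool, F (i.insertNth true y) := by
  rw [← Equiv.sum_comp (Fin.insertNthEquiv (fun _ => Bool) i) F, Fintype.sum_prod_type,
    Fintype.sum_bool, add_comm]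
  rfl

/-- A robust form of Talagrand's inequality: every sensitive edge may be charged to either of
its endpoints. -/
theorem talagrand_of_charge (n : ℕ) (g : (Fin n → Bool) → ℝ) (q : Fin n → (Fin n → Bool) → ℝ)
    (hg : ∀ x, |g x| ≤ 1)
    (hq : ∀ j x, |g x - g (flipAt j x)| ≤ q j x + q j (flipAt j x)) :
    2 ^ n * ∑ x, g x ^ 2 - (∑ x, g x) ^ 2 ≤ 2 * 2 ^ n * ∑ x, √(∑ j, q j x ^ 2) := by
  induction n with
  | zero => simp
  | succ n ih =>
    set T := ∑ x, √(∑ j, q j x ^ 2) with hT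
    have key : ∀ i, 2 ^ (n + 1) * ∑ x, g x ^ 2 - (∑ x, g x) ^ 2 ≤
        (∑ x, coordSign i x * g x) ^ 2
          + 4 * 2 ^ n * ∑ x, √(∑ j, q j x ^ 2 - q i x ^ 2) := by
      intro i
      have hb : ∀ b : Bool, _ := fun b => ih (fun y => g (i.insertNth b y))
        (fun j y => q (i.succAbove j) (i.insertNth b y)) (fun y => hg _)
        (fun j y => by rw [← flipAt_insertNth]; exact hq _ _)
      have h0 := hb false
      have h1 := hb true
      have hs : ∀ x, ∑ j, q j x ^ 2 - q i x ^ 2 = ∑ j, q (i.succAbove j) x ^ 2 := by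
        intro x; rw [Fin.sum_univ_succAbove _ i]; ring
      simp_rw [hs]
      rw [sum_eq_sum_insertNth i fun x => g x ^ 2, sum_eq_sum_insertNth i g,
        sum_eq_sum_insertNth i fun x => coordSign i x * g x,
        sum_eq_sum_insertNth i fun x => √(∑ j, q (i.succAbove j) x ^ 2)]
      simp only [coordSign, Fin.insertNth_apply_same, Bool.false_eq_true, if_true, if_false,
        one_mul, neg_one_mul, Finset.sum_neg_distrib]
      rw [pow_succ]
      nlinarith
    have hsum := Finset.sum_le_sum fun i (_ : i ∈ Finset.univ) => key i
    simp only [Finset.sum_const, Finset.card_univ, Fintype.card_fin, nsmul_eq_mul,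
      Finset.sum_add_distrib, ← Finset.mul_sum] at hsum
    have hW := sum_sq_sum_coordSign_mul_le_sum_sqrt g q hg hq
    rw [Fintype.card_fin, ← hT] at hW
    have hR : ∑ i, ∑ x, √(∑ j, q j x ^ 2 - q i x ^ 2) ≤ ((n : ℝ) + 1 / 2) * T := by
      rw [Finset.sum_comm, hT, Finset.mul_sum]
      exact Finset.sum_le_sum fun x _ => sum_sqrt_sum_sub_le n _ fun i => sq_nonneg _
    have hp : (0 : ℝ) < 2 ^ n := by positivity
    have hR' := mul_le_mul_of_nonneg_left hR (by positivity : (0 : ℝ) ≤ 4 * 2 ^ n)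
    have hm : (0 : ℝ) < ((n + 1 : ℕ) : ℝ) := by positivity
    refine le_of_mul_le_mul_left ?_ hm
    push_cast at *
    rw [pow_succ] at *
    nlinarith

end Talagrand

section Sorting

/-- The value at a point after sorting along one direction: `b` is the coordinate of the point
in that direction, `a` the old value at the point and `c` the old value at its neighbour. -/
def sortVal (b a c : Bool) : Bool := if b then a || c else a && c

/-- The charge at a point after sorting along one direction. Charges of a pair with distinct
values follow the values, charges of a pair with equal values are themselves sorted, increasingly
if the value is `false` and decreasingly if it is `true`. -/
def moveVal (b a a' p p' : Bool) : Bool :=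
  if a = a' then (if a = b then p && p' else p || p') else (if a = b then p else p')

theorem moveVal_cover : ∀ b a a' c c' p p' r r' : Bool,
    (a = true → c = false → (p || r) = true) → (a' = true → c' = false → (p' || r') = true) →
    sortVal b a a' = true → sortVal b c c' = false →
    (moveVal b a a' p p' || moveVal b c c' r r') = true := by
  decide

variable {ι : Type*}

/-- The charges `p` of `h` and `r` of `k` cover every point where `h` and `k` differ. -/
def CoversDiff (h k p r : (ι → Bool) → Bool) : Prop :=
  ∀ x, h x ≠ k x → (p x || r x) = true

theorem CoversDiff.symm {h k p r : (ι → Bool) → Bool} (H : CoversDiff h k p r) :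
    CoversDiff k h r p := fun x hx => by rw [Bool.or_comm]; exact H x hx.symm

variable [DecidableEq ι]

/-- Sort a Boolean function along direction `i`. -/
def sortDir (i : ι) (h : (ι → Bool) → Bool) (x : ι → Bool) : Bool :=
  sortVal (x i) (h x) (h (flipAt i x))

/-- Transport of a charge `q` when `h` is sorted along direction `i`. -/
def moveDir (i : ι) (h q : (ι → Bool) → Bool) (x : ι → Bool) : Bool :=
  moveVal (x i) (h x) (h (flipAt i x)) (q x) (q (flipAt i x))

/-- Sort a Boolean function along the directions of a list, from left to right. -/
def sortList : List ι → ((ι → Bool) → Bool) → (ι → Bool) → Bool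
  | [], h => h
  | i :: L, h => sortList L (sortDir i h)

/-- Transport of a charge along the sorting of `h` along the directions of a list. -/
def moveList : List ι → ((ι → Bool) → Bool) → ((ι → Bool) → Bool) → (ι → Bool) → Bool
  | [], _, q => q
  | i :: L, h, q => moveList L (sortDir i h) (moveDir i h q)

theorem sortList_append (L M : List ι) (h : (ι → Bool) → Bool) :
    sortList (L ++ M) h = sortList M (sortList L h) := by
  induction L generalizing h with
  | nil => rfl
  | cons i L ih => exact ih _

/-- The charge `q` covers every edge in direction `j` violated by `h`. -/
def CoversDir (j : ι) (h q : (ι → Bool) → Bool) : Prop :=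
  ∀ x, x j = false → h x = true → h (flipAt j x) = false → (q x || q (flipAt j x)) = true

theorem CoversDiff.sortDir {h k p r : (ι → Bool) → Bool} (H : CoversDiff h k p r) (i : ι) :
    CoversDiff (sortDir i h) (sortDir i k) (moveDir i h p) (moveDir i k r) := by
  have aux : ∀ {h k p r : (ι → Bool) → Bool}, CoversDiff h k p r → ∀ x,
      _root_.sortDir i h x = true → _root_.sortDir i k x = false →
      (moveDir i h p x || moveDir i k r x) = true := fun H x =>
    moveVal_cover _ _ _ _ _ _ _ _ _ (fun h1 h2 => H x (by simp [h1, h2]))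
      (fun h1 h2 => H (flipAt i x) (by simp [h1, h2]))
  intro x hx
  cases h1 : _root_.sortDir i h x <;> cases h2 : _root_.sortDir i k x
  · simp [h1, h2] at hx
  · rw [Bool.or_comm]; exact aux H.symm x h2 h1
  · exact aux H x h1 h2
  · simp [h1, h2] at hx

theorem CoversDiff.sortList {h k p r : (ι → Bool) → Bool} (H : CoversDiff h k p r)
    (L : List ι) :
    CoversDiff (sortList L h) (sortList L k) (moveList L h p) (moveList L k r) := by
  induction L generalizing h k p r with
  | nil => exact H
  | cons i L ih => exact ih (H.sortDir i)

theorem CoversDir.sortDir {i j : ι} (hij : i ≠ j) {h q : (ι → Bool) → Bool}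
    (H : CoversDir j h q) : CoversDir j (sortDir i h) (moveDir i h q) := by
  intro x hx h1 h2
  have e : flipAt j x i = x i := flipAt_of_ne hij x
  simp only [_root_.sortDir, moveDir, e] at h1 h2 ⊢
  refine moveVal_cover _ _ _ _ _ _ _ _ _ (H x hx) ?_ h1 h2
  rw [flipAt_comm i j]
  exact H _ (by rw [flipAt_of_ne hij.symm, hx])

theorem CoversDir.coversDiff {j : ι} {h q : (ι → Bool) → Bool} (H : CoversDir j h q) :
    CoversDiff h (_root_.sortDir j h) q (moveDir j h q) := by
  intro x hx
  have h1 := H x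
  have h2 := H (flipAt j x)
  simp only [flipAt_same, flipAt_flipAt] at h2
  revert hx h1 h2
  simp only [_root_.sortDir, moveDir]
  generalize x j = b
  generalize h x = a
  generalize h (flipAt j x) = a'
  generalize q x = p
  generalize q (flipAt j x) = p'
  revert p' p a' a b
  decide

/-- Toggling whether the direction `j` is sorted changes the sorted function only at points that
are covered by the transported charges. -/
theorem CoversDir.coversDiff_filter {j : ι} {h q : (ι → Bool) → Bool} (H : CoversDir j h q)
    {L : List ι} (hL : L.Nodup) (y : ι → Bool) :
    CoversDiff (_root_.sortList (L.filter y) h) (_root_.sortList (L.filter (flipAt j y)) h)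
      (moveList (L.filter y) h q) (moveList (L.filter (flipAt j y)) h q) := by
  have hsame : ∀ {M : List ι}, j ∉ M → M.filter (flipAt j y) = M.filter y := fun {M} hM =>
    List.filter_congr fun i hi => flipAt_of_ne (fun e : i = j => hM (e ▸ hi)) y
  induction L generalizing h q with
  | nil => exact fun x hx => (hx rfl).elim
  | cons i L ih =>
    obtain ⟨hi, hL⟩ := List.nodup_cons.1 hL
    by_cases hij : i = j
    · subst hij
      cases hy : y i
      · rw [List.filter_cons_of_neg (by simp [hy]), List.filter_cons_of_pos (by simp [hy]),
          hsame hi]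
        exact H.coversDiff.sortList _
      · rw [List.filter_cons_of_pos (by simp [hy]), List.filter_cons_of_neg (by simp [hy]),
          hsame hi]
        exact (H.coversDiff.sortList _).symm
    · have e : flipAt j y i = y i := flipAt_of_ne hij y
      cases hy : y i
      · rw [List.filter_cons_of_neg (by simp [hy]), List.filter_cons_of_neg (by simp [e, hy])]
        exact ih H hL
      · rw [List.filter_cons_of_pos (by simp [hy]), List.filter_cons_of_pos (by simp [e, hy])]
        exact ih (H.sortDir hij) hL

/-- `h` is monotone in direction `i`. -/
def MonoDir (i : ι) (h : (ι → Bool) → Bool) : Prop :=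
  ∀ x, x i = false → h x = true → h (flipAt i x) = true

theorem monoDir_sortDir_self (i : ι) (h : (ι → Bool) → Bool) : MonoDir i (sortDir i h) := by
  intro x hx h1
  simp only [sortDir, flipAt_same, flipAt_flipAt, hx, sortVal] at h1 ⊢
  simp_all

theorem MonoDir.sortDir {i j : ι} {h : (ι → Bool) → Bool} (H : MonoDir i h) :
    MonoDir i (sortDir j h) := by
  by_cases hij : j = i
  · subst hij; exact monoDir_sortDir_self _ _
  intro x hx
  have h1 := H x hx
  have h2 := H (flipAt j x) (by rw [flipAt_of_ne (Ne.symm hij), hx])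
  simp only [_root_.sortDir, sortVal, flipAt_of_ne hij, flipAt_comm j i x]
  cases x j <;> simp <;> tauto

theorem MonoDir.sortList {i : ι} {h : (ι → Bool) → Bool} (H : MonoDir i h) (L : List ι) :
    MonoDir i (sortList L h) := by
  induction L generalizing h with
  | nil => exact H
  | cons j L ih => exact ih H.sortDir

theorem monoDir_sortList {i : ι} {L : List ι} (hi : i ∈ L) (h : (ι → Bool) → Bool) :
    MonoDir i (sortList L h) := by
  induction L generalizing h with
  | nil => simp at hi
  | cons j L ih =>
    rcases List.mem_cons.1 hi with rfl | hi
    · exact (monoDir_sortDir_self _ _).sortList L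
    · exact ih hi _

theorem sortDir_eq_self {i : ι} {h : (ι → Bool) → Bool} (H : MonoDir i h) :
    sortDir i h = h := by
  ext x
  have h1 := H x
  have h2 := H (flipAt i x)
  simp only [flipAt_same, flipAt_flipAt] at h2
  revert h1 h2
  simp only [sortDir, sortVal]
  generalize x i = b
  generalize h x = a
  generalize h (flipAt i x) = a'
  revert b a a'
  decide

theorem sortList_eq_self {L : List ι} {h : (ι → Bool) → Bool} (H : ∀ i ∈ L, MonoDir i h) :
    sortList L h = h := by
  induction L with
  | nil => rfl
  | cons j L ih =>
    rw [sortList, sortDir_eq_self (H j (by simp))]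
    exact ih fun i hi => H i (by simp [hi])

variable [Fintype ι]

/-- The number of points where two Boolean functions differ. -/
def hamDist (h k : (ι → Bool) → Bool) : ℝ := ∑ x, if h x = k x then 0 else 1

theorem hamDist_comm (h k : (ι → Bool) → Bool) : hamDist h k = hamDist k h := by
  simp [hamDist, eq_comm]

theorem hamDist_self (h : (ι → Bool) → Bool) : hamDist h h = 0 := by simp [hamDist]

theorem hamDist_triangle (h k l : (ι → Bool) → Bool) :
    hamDist h l ≤ hamDist h k + hamDist k l := by
  rw [hamDist, hamDist, hamDist, ← Finset.sum_add_distrib]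
  refine Finset.sum_le_sum fun x _ => ?_
  cases h x <;> cases k x <;> cases l x <;> norm_num

theorem sortVal_ne_add_le (b a a' c c' : Bool) :
    (if sortVal b a a' = sortVal b c c' then (0 : ℝ) else 1) +
      (if sortVal (!b) a' a = sortVal (!b) c' c then 0 else 1) ≤
    (if a = c then 0 else 1) + (if a' = c' then 0 else 1) := by
  cases b <;> cases a <;> cases a' <;> cases c <;> cases c' <;> norm_num [sortVal]

theorem hamDist_sortDir_le (i : ι) (h k : (ι → Bool) → Bool) :
    hamDist (sortDir i h) (sortDir i k) ≤ hamDist h k := by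
  refine sum_le_sum_of_flip i _ _ fun x => ?_
  simp only [sortDir, flipAt_same, flipAt_flipAt]
  exact sortVal_ne_add_le _ _ _ _ _

theorem hamDist_sortList_le (L : List ι) (h k : (ι → Bool) → Bool) :
    hamDist (sortList L h) (sortList L k) ≤ hamDist h k := by
  induction L generalizing h k with
  | nil => exact le_rfl
  | cons i L ih => exact (ih _ _).trans (hamDist_sortDir_le i h k)

/-- The number of charges at a point. -/
def chargeCount (q : ι → (ι → Bool) → Bool) (x : ι → Bool) : ℝ :=
  ∑ j, if q j x then 1 else 0

theorem sqrt_add_sqrt_le_of_spread {a b c e : ℝ} (ha : 0 ≤ a) (hab : a ≤ b) (hac : a ≤ c)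
    (h : a + e = b + c) : √a + √e ≤ √b + √c := by
  have hb : 0 ≤ b := ha.trans hab
  have hc : 0 ≤ c := ha.trans hac
  have he : 0 ≤ e := by linarith
  refine abs_le_of_sq_le_sq' ?_ (by positivity) |>.2
  have h1 : √a * √e ≤ √b * √c := by
    rw [← Real.sqrt_mul ha, ← Real.sqrt_mul hb]
    exact Real.sqrt_le_sqrt (by nlinarith [mul_nonneg (sub_nonneg.2 hab) (sub_nonneg.2 hac)])
  nlinarith [Real.sq_sqrt ha, Real.sq_sqrt hb, Real.sq_sqrt hc, Real.sq_sqrt he]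

theorem sum_sqrt_chargeCount_moveDir_le (i : ι) (h : (ι → Bool) → Bool)
    (q : ι → (ι → Bool) → Bool) :
    ∑ x, √(chargeCount (fun j => moveDir i h (q j)) x) ≤ ∑ x, √(chargeCount q x) := by
  refine sum_le_sum_of_flip i _ _ fun x => ?_
  have hspread : ∀ y, √(∑ j, if q j y && q j (flipAt i y) then (1 : ℝ) else 0) +
      √(∑ j, if q j y || q j (flipAt i y) then (1 : ℝ) else 0) ≤
      √(chargeCount q y) + √(chargeCount q (flipAt i y)) := by
    intro y
    refine sqrt_add_sqrt_le_of_spread (Finset.sum_nonneg fun j _ => by split_ifs <;> norm_num)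
      (Finset.sum_le_sum fun j _ => ?_) (Finset.sum_le_sum fun j _ => ?_) ?_
    · cases q j y <;> cases q j (flipAt i y) <;> norm_num
    · cases q j y <;> cases q j (flipAt i y) <;> norm_num
    · rw [chargeCount, chargeCount, ← Finset.sum_add_distrib, ← Finset.sum_add_distrib]
      refine Finset.sum_congr rfl fun j _ => ?_
      cases q j y <;> cases q j (flipAt i y) <;> norm_num
  have h1 := hspread x
  have hand := fun j => Bool.and_comm (q j (flipAt i x)) (q j x)
  have hor := fun j => Bool.or_comm (q j (flipAt i x)) (q j x)
  simp only [chargeCount, moveDir, moveVal, flipAt_same, flipAt_flipAt, hand, hor] at h1 ⊢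
  rcases Bool.eq_false_or_eq_true (x i) with e1 | e1 <;>
    rcases Bool.eq_false_or_eq_true (h x) with e2 | e2 <;>
    rcases Bool.eq_false_or_eq_true (h (flipAt i x)) with e3 | e3 <;>
    simp only [e1, e2, e3, Bool.not_true, Bool.not_false, if_true, if_false, reduceCtorEq] <;>
    linarith

theorem sum_sqrt_chargeCount_moveList_le (L : List ι) (h : (ι → Bool) → Bool)
    (q : ι → (ι → Bool) → Bool) :
    ∑ x, √(chargeCount (fun j => moveList L h (q j)) x) ≤ ∑ x, √(chargeCount q x) := by
  induction L generalizing h q with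
  | nil => exact le_rfl
  | cons i L ih => exact (ih _ _).trans (sum_sqrt_chargeCount_moveDir_le i h q)

end Sorting

section MonoDist

variable {ι : Type*} [DecidableEq ι] [Fintype ι]

/-- The number of points at which a Boolean function must be changed to become monotone. -/
noncomputable def monoDist (h : (ι → Bool) → Bool) : ℝ :=
  ⨅ k : {k : (ι → Bool) → Bool // ∀ i, MonoDir i k}, hamDist h k

instance : Nonempty {k : (ι → Bool) → Bool // ∀ i, MonoDir i k} :=
  ⟨⟨fun _ => true, fun _ _ _ _ => rfl⟩⟩

theorem monoDist_le {h k : (ι → Bool) → Bool} (hk : ∀ i, MonoDir i k) :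
    monoDist h ≤ hamDist h k :=
  ciInf_le (Set.finite_range _).bddBelow
    (⟨k, hk⟩ : {k : (ι → Bool) → Bool // ∀ i, MonoDir i k})

theorem exists_monoDist_eq (h : (ι → Bool) → Bool) :
    ∃ k, (∀ i, MonoDir i k) ∧ hamDist h k = monoDist h := by
  obtain ⟨k, hk⟩ := exists_eq_ciInf_of_finite
    (f := fun k : {k : (ι → Bool) → Bool // ∀ i, MonoDir i k} => hamDist h k)
  exact ⟨k, k.2, hk⟩

theorem monoDist_le_hamDist_add (h k : (ι → Bool) → Bool) :
    monoDist h ≤ hamDist h k + monoDist k := by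
  obtain ⟨l, hl, e⟩ := exists_monoDist_eq k
  rw [← e]
  exact (monoDist_le hl).trans (hamDist_triangle h k l)

theorem monoDist_le_zero {h : (ι → Bool) → Bool} (H : ∀ i, MonoDir i h) : monoDist h ≤ 0 :=
  (monoDist_le H).trans_eq (hamDist_self h)

end MonoDist

section Halving

variable {ι : Type*} [DecidableEq ι] [Fintype ι]

/-- If `X` is controlled by its average over random halves of `u`, up to an error which shrinks
geometrically under halving, then `X` is controlled by the error. -/
theorem le_of_halving (X T : (ι → Bool) → ℝ) (K : ℝ) (hX0 : X (fun _ => false) ≤ 0)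
    (hK : 0 ≤ K) (hT0 : ∀ u, 0 ≤ T u)
    (hT : ∀ u, ∑ y : ι → Bool, T (fun i => u i && y i) ≤ 2 ^ Fintype.card ι * (3 / 4 * T u))
    (hX : ∀ u, 2 ^ Fintype.card ι * X u ≤
      ∑ y : ι → Bool, X (fun i => u i && y i) + 2 ^ Fintype.card ι * (K * T u))
    (u : ι → Bool) : X u ≤ 4 * K * T u := by
  induction hn : (Finset.univ.filter fun i => u i = true).card using Nat.strong_induction_on
    generalizing u with
  | _ n ih =>
  by_cases hu : u = fun _ => false
  · subst hu
    exact hX0.trans (by have := hT0 (fun _ => false); positivity)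
  set N : ℝ := 2 ^ Fintype.card ι with hN
  set B : Finset (ι → Bool) := Finset.univ.filter fun y => (fun i => u i && y i) = u with hB
  have hBlt : (B.card : ℝ) < N := by
    have : B ⊂ Finset.univ := by
      refine Finset.ssubset_univ_iff.2 fun e => hu ?_
      have : (fun _ => false) ∈ B := e ▸ Finset.mem_univ _
      simpa [hB] using (Finset.mem_filter.1 this).2.symm
    have h2 := Finset.card_lt_card this
    rw [Finset.card_univ, Fintype.card_fun, Fintype.card_bool] at h2
    rw [hN]
    exact_mod_cast h2
  have hle : ∑ y : ι → Bool, X (fun i => u i && y i) ≤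
      ∑ y : ι → Bool, (4 * K * T (fun i => u i && y i) +
        if (fun i => u i && y i) = u then X u - 4 * K * T u else 0) := by
    refine Finset.sum_le_sum fun y _ => ?_
    split_ifs with h
    · rw [h]; linarith
    · rw [add_zero]
      refine ih _ ?_ _ rfl
      rw [← hn]
      refine Finset.card_lt_card ⟨fun i => by simp +contextual, fun hsub => h ?_⟩
      ext i
      cases hi : u i
      · simp
      · have := hsub (by simp [hi] : i ∈ Finset.univ.filter fun i => u i = true)
        simpa [hi] using this
  rw [Finset.sum_add_distrib, ← Finset.mul_sum, ← Finset.sum_filter, Finset.sum_const,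
    nsmul_eq_mul] at hle
  have h1 := hX u
  have h2 := mul_le_mul_of_nonneg_left (hT u) (by positivity : 0 ≤ 4 * K)
  have h3 : (N - B.card) * (X u - 4 * K * T u) ≤ 0 := by nlinarith
  have h4 : 0 < N - B.card := sub_pos.2 hBlt
  by_contra hcon
  push Not at hcon
  have := mul_pos h4 (sub_pos.2 hcon)
  linarith

theorem sum_sqrt_chargeCount_half_le (q : ι → (ι → Bool) → Bool) (x : ι → Bool) :
    ∑ y : ι → Bool, √(chargeCount (fun j x => y j && q j x) x) ≤
      2 ^ Fintype.card ι * (3 / 4 * √(chargeCount q x)) := by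
  set N : ℝ := 2 ^ Fintype.card ι with hN
  have hc0 : ∀ q : ι → (ι → Bool) → Bool, 0 ≤ chargeCount q x := fun q =>
    Finset.sum_nonneg fun j _ => by split_ifs <;> norm_num
  have hsum : ∑ y : ι → Bool, chargeCount (fun j x => y j && q j x) x =
      N / 2 * chargeCount q x := by
    simp only [chargeCount]
    rw [Finset.sum_comm, Finset.mul_sum]
    refine Finset.sum_congr rfl fun j _ => ?_
    have h1 := sum_flipAt j fun y : ι → Bool => if (y j && q j x) = true then (1 : ℝ) else 0
    have h2 : ∑ y : ι → Bool, ((if (y j && q j x) = true then (1 : ℝ) else 0) +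
        if (flipAt j y j && q j x) = true then (1 : ℝ) else 0) =
        ∑ _y : ι → Bool, if q j x = true then (1 : ℝ) else 0 :=
      Finset.sum_congr rfl fun y _ => by
        rw [flipAt_same]; cases y j <;> cases q j x <;> norm_num
    rw [Finset.sum_add_distrib, h1, Finset.sum_const, Finset.card_univ, Fintype.card_fun,
      Fintype.card_bool, nsmul_eq_mul] at h2
    push_cast at h2
    rw [hN]
    linarith
  have h1 := Real.sum_sqrt_mul_sqrt_le (Finset.univ : Finset (ι → Bool))
    (f := fun _ => 1) (g := fun y => chargeCount (fun j x => y j && q j x) x)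
    (fun _ => zero_le_one) fun y => hc0 _
  simp only [Real.sqrt_one, one_mul, Finset.sum_const, Finset.card_univ, Fintype.card_fun,
    Fintype.card_bool, nsmul_eq_mul, mul_one, hsum] at h1
  refine h1.trans ?_
  push_cast
  rw [← hN, ← Real.sqrt_mul (by positivity)]
  refine Real.sqrt_le_iff.2 ⟨by positivity, ?_⟩
  rw [mul_pow, mul_pow, Real.sq_sqrt (hc0 q)]
  nlinarith [mul_nonneg (sq_nonneg N) (hc0 q)]

end Halving

section Tracker

theorem sum_not {ι M : Type*} [DecidableEq ι] [Fintype ι] [AddCommMonoid M]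
    (F : (ι → Bool) → M) : ∑ y : ι → Bool, F (fun i => !y i) = ∑ y, F y :=
  Equiv.sum_comp (Function.Involutive.toPerm (fun (y : ι → Bool) i => !y i)
    fun y => by simp) F

/-- The expected squared difference between antipodal values is at most four times the
variance. -/
theorem sum_sq_sub_not_le {ι : Type*} [DecidableEq ι] [Fintype ι] (g : (ι → Bool) → ℝ) :
    2 ^ Fintype.card ι * ∑ y : ι → Bool, (g (fun i => !y i) - g y) ^ 2 ≤
      4 * (2 ^ Fintype.card ι * ∑ y, g y ^ 2 - (∑ y, g y) ^ 2) := by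
  set N : ℝ := 2 ^ Fintype.card ι with hN
  have hcard : ((Finset.univ : Finset (ι → Bool)).card : ℝ) = N := by
    rw [Finset.card_univ, Fintype.card_fun, Fintype.card_bool, hN]; push_cast; rfl
  have h1 : ∑ y : ι → Bool, (g (fun i => !y i) - g y) ^ 2 =
      2 * ∑ y, g y ^ 2 - 2 * ∑ y : ι → Bool, g (fun i => !y i) * g y := by
    have := sum_not fun y => g y ^ 2
    have e : ∀ y : ι → Bool, (g (fun i => !y i) - g y) ^ 2 =
      g (fun i => !y i) ^ 2 + g y ^ 2 - 2 * (g (fun i => !y i) * g y) := fun y => by ring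
    simp_rw [e]
    rw [Finset.sum_sub_distrib, Finset.sum_add_distrib, this, ← Finset.mul_sum]
    ring
  have h2 : 0 ≤ ∑ y : ι → Bool, (N * g (fun i => !y i) + N * g y - 2 * ∑ y, g y) ^ 2 :=
    Finset.sum_nonneg fun y _ => sq_nonneg _
  have h3 : ∑ y : ι → Bool, (N * g (fun i => !y i) + N * g y - 2 * ∑ y, g y) ^ 2 =
      N * (2 * N * ∑ y, g y ^ 2 + 2 * N * ∑ y : ι → Bool, g (fun i => !y i) * g y
        - 4 * (∑ y, g y) ^ 2) := by
    have e1 := sum_not fun y => g y ^ 2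
    have e2 := sum_not g
    set s := ∑ y, g y
    have e : ∀ y : ι → Bool, (N * g (fun i => !y i) + N * g y - 2 * s) ^ 2 =
      N ^ 2 * g (fun i => !y i) ^ 2 + N ^ 2 * g y ^ 2 + 2 * N ^ 2 * (g (fun i => !y i) * g y)
        - 4 * N * s * g (fun i => !y i) - 4 * N * s * g y + 4 * s ^ 2 := fun y => by ring
    simp_rw [e]
    simp only [Finset.sum_sub_distrib, Finset.sum_add_distrib, ← Finset.mul_sum, e1, e2,
      Finset.sum_const, nsmul_eq_mul, hcard]
    ring
  have hNpos : 0 < N := by positivity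
  have h4 := nonneg_of_mul_nonneg_right (h3 ▸ h2) hNpos
  rw [h1]
  nlinarith

variable {d : ℕ}

/-- Sorting along the directions of a random half of a list and sorting along the complementary
half give close results. -/
theorem sum_hamDist_filter_le {L : List (Fin d)} (hL : L.Nodup) (f : (Fin d → Bool) → Bool)
    (q : Fin d → (Fin d → Bool) → Bool) (hq : ∀ j ∈ L, CoversDir j f (q j)) :
    ∑ y : Fin d → Bool,
      hamDist (sortList (L.filter fun i => !y i) f) (sortList (L.filter y) f) ≤
      2 ^ d * (8 * ∑ x, √(chargeCount q x)) := by
  have hpt : ∀ x, ∑ y : Fin d → Bool,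
      (if sortList (L.filter fun i => !y i) f x = sortList (L.filter y) f x then (0 : ℝ) else 1) ≤
      8 * ∑ y : Fin d → Bool, √(chargeCount (fun j => moveList (L.filter y) f (q j)) x) := by
    intro x
    set g : (Fin d → Bool) → ℝ := fun y => if sortList (L.filter y) f x then 1 else 0 with hg
    have e1 : ∀ y : Fin d → Bool, (if sortList (L.filter fun i => !y i) f x =
        sortList (L.filter y) f x then (0 : ℝ) else 1) = (g (fun i => !y i) - g y) ^ 2 := by
      intro y
      simp only [hg]
      cases sortList (L.filter fun i => !y i) f x <;> cases sortList (L.filter y) f x <;>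
        norm_num
    have h1 := sum_sq_sub_not_le g
    have h2 := talagrand_of_charge d g
      (fun j y => if moveList (L.filter y) f (q j) x then 1 else 0)
      (fun y => by simp only [hg]; split_ifs <;> norm_num)
      (fun j y => by
        by_cases hj : j ∈ L
        · have := (hq j hj).coversDiff_filter hL y x
          revert this
          simp only [hg]
          generalize sortList (L.filter y) f x = a
          generalize sortList (L.filter (flipAt j y)) f x = b
          generalize moveList (L.filter y) f (q j) x = p
          generalize moveList (L.filter (flipAt j y)) f (q j) x = r
          cases a <;> cases b <;> cases p <;> cases r <;> norm_num
        · have : L.filter (flipAt j y) = L.filter y :=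
            List.filter_congr fun i hi => flipAt_of_ne (fun e : i = j => hj (e ▸ hi)) y
          simp only [hg, this, sub_self, abs_zero]
          positivity)
    rw [Fintype.card_fin] at h1
    simp only [ite_pow, one_pow, ne_eq, OfNat.ofNat_ne_zero, not_false_eq_true, zero_pow] at h2
    simp_rw [e1]
    have hp : (0 : ℝ) < 2 ^ d := by positivity
    refine le_of_mul_le_mul_left (h1.trans ?_) hp
    simp only [chargeCount]
    simp only [hg, ite_pow, one_pow, ne_eq, OfNat.ofNat_ne_zero, not_false_eq_true, zero_pow] at h2 ⊢
    linarith
  simp only [hamDist]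
  rw [Finset.sum_comm]
  refine (Finset.sum_le_sum fun x _ => hpt x).trans ?_
  rw [← Finset.mul_sum, Finset.sum_comm]
  have h1 := Finset.sum_le_sum fun y (_ : y ∈ (Finset.univ : Finset (Fin d → Bool))) =>
    sum_sqrt_chargeCount_moveList_le (L.filter y) f q
  rw [Finset.sum_const, Finset.card_univ, Fintype.card_fun, Fintype.card_bool,
    Fintype.card_fin, nsmul_eq_mul] at h1
  push_cast at h1
  linarith

theorem sum_monoDist_filter_le {L : List (Fin d)} (hL : L.Nodup) (f : (Fin d → Bool) → Bool)
    (q : Fin d → (Fin d → Bool) → Bool) (hq : ∀ j ∈ L, CoversDir j f (q j)) :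
    ∑ y : Fin d → Bool, monoDist (sortList (L.filter y) f) ≤
      2 ^ d * (8 * ∑ x, √(chargeCount q x)) +
      ∑ y : Fin d → Bool, monoDist (sortList ((L.filter fun i => !y i) ++ L.filter y) f) := by
  refine le_trans ?_ (add_le_add_left (sum_hamDist_filter_le hL f q hq) _)
  rw [← Finset.sum_add_distrib]
  refine Finset.sum_le_sum fun y _ => ?_
  refine (monoDist_le_hamDist_add _ (sortList ((L.filter fun i => !y i) ++ L.filter y) f)).trans
    (add_le_add_left ?_ _)
  have e : sortList (L.filter y) (sortList (L.filter y) f) = sortList (L.filter y) f :=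
    sortList_eq_self fun i hi => monoDir_sortList hi f
  have := hamDist_sortList_le (L.filter y) (sortList (L.filter fun i => !y i) f)
    (sortList (L.filter y) f)
  rwa [e, hamDist_comm, ← sortList_append] at this

theorem exists_perm_map_finRange_eq {l : List (Fin d)} (hl : l.Perm (List.finRange d)) :
    ∃ ρ : Equiv.Perm (Fin d), (List.finRange d).map ρ = l := by
  have hlen : l.length = d := by rw [hl.length_eq, List.length_finRange]
  have hnd : l.Nodup := hl.nodup_iff.2 (List.nodup_finRange d)
  have hinj : Function.Injective fun i : Fin d => l[i.1]'(by omega) := fun i j h =>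
    Fin.ext ((List.Nodup.getElem_inj_iff hnd).1 h)
  refine ⟨Equiv.ofBijective _ (Finite.injective_iff_bijective.1 hinj), ?_⟩
  refine List.ext_getElem (by simp [hlen]) fun i h1 h2 => ?_
  simp

/-- Splitting a uniformly random order of a set of directions by a random bit keeps it uniformly
random. -/
theorem sum_perm_filter_append (Φ : List (Fin d) → ℝ) (u : Fin d → Bool) :
    ∑ σ : Equiv.Perm (Fin d), ∑ y : Fin d → Bool,
      Φ (((((List.finRange d).map σ).filter u).filter fun i => !y i) ++
        (((List.finRange d).map σ).filter u).filter y) =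
    2 ^ d * ∑ σ : Equiv.Perm (Fin d), Φ (((List.finRange d).map σ).filter u) := by
  have h1 : ∀ σ : Equiv.Perm (Fin d), ∑ y : Fin d → Bool,
      Φ (((((List.finRange d).map σ).filter u).filter fun i => !y i) ++
        (((List.finRange d).map σ).filter u).filter y) = ∑ z : Fin d → Bool,
      Φ (((((List.finRange d).filter fun i => !z i) ++ (List.finRange d).filter z).map σ).filter
        u) := by
    intro σ
    rw [← Equiv.sum_comp (σ.arrowCongr (Equiv.refl Bool))]
    refine Finset.sum_congr rfl fun z _ => ?_
    congr 1
    simp only [List.map_append, List.filter_append, List.filter_map, List.filter_filter]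
    congr 2 <;> refine List.filter_congr fun i _ => ?_ <;>
      simp [Equiv.arrowCongr, Bool.and_comm]
  simp_rw [h1]
  rw [Finset.sum_comm]
  have h2 : ∀ z : Fin d → Bool, ∑ σ : Equiv.Perm (Fin d),
      Φ (((((List.finRange d).filter fun i => !z i) ++ (List.finRange d).filter z).map σ).filter
        u) = ∑ σ : Equiv.Perm (Fin d), Φ (((List.finRange d).map σ).filter u) := by
    intro z
    obtain ⟨ρ, hρ⟩ := exists_perm_map_finRange_eq
      (l := ((List.finRange d).filter fun i => !z i) ++ (List.finRange d).filter z)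
      (List.perm_append_comm.trans (List.filter_append_perm z (List.finRange d)))
    rw [← hρ, ← Equiv.sum_comp (Equiv.mulRight ρ) fun σ : Equiv.Perm (Fin d) =>
      Φ (((List.finRange d).map σ).filter u)]
    refine Finset.sum_congr rfl fun σ _ => ?_
    rw [List.map_map]
    rfl
  simp_rw [h2]
  simp

/-- The directed Talagrand inequality for Boolean functions. -/
theorem monoDist_le_sum_sqrt (f : (Fin d → Bool) → Bool) (q : Fin d → (Fin d → Bool) → Bool)
    (hq : ∀ j, CoversDir j f (q j)) : monoDist f ≤ 32 * ∑ x, √(chargeCount q x) := by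
  set P : ℝ := ((Fintype.card (Equiv.Perm (Fin d)) : ℕ) : ℝ) with hP
  have hPpos : 0 < P := by rw [hP]; exact_mod_cast Fintype.card_pos
  set X : (Fin d → Bool) → ℝ := fun u => ∑ σ : Equiv.Perm (Fin d),
    (monoDist f - monoDist (sortList (((List.finRange d).map σ).filter u) f)) with hXdef
  set T : (Fin d → Bool) → ℝ := fun u => P * ∑ x, √(chargeCount (fun j x => u j && q j x) x)
    with hTdef
  have main := le_of_halving X T 8 (by simp [hXdef, sortList]) (by norm_num)
    (fun u => mul_nonneg hPpos.le (Finset.sum_nonneg fun x _ => Real.sqrt_nonneg _))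
    (fun u => by
      simp only [hTdef]
      rw [← Finset.mul_sum, Finset.sum_comm]
      have := Finset.sum_le_sum fun x (_ : x ∈ Finset.univ) =>
        sum_sqrt_chargeCount_half_le (fun j x => u j && q j x) x
      rw [← Finset.mul_sum, ← Finset.mul_sum] at this
      have e : ∀ y : Fin d → Bool, (fun j (x : Fin d → Bool) => (u j && y j) && q j x) =
          fun j x => y j && (u j && q j x) := fun y => by
        ext j x; cases u j <;> simp
      simp only [e]
      have := mul_le_mul_of_nonneg_left this hPpos.le
      linarith)
    (fun u => by
      have hstep := Finset.sum_le_sum fun (σ : Equiv.Perm (Fin d)) (_ : σ ∈ Finset.univ) =>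
        sum_monoDist_filter_le
          (((List.nodup_finRange d).map σ.injective).filter u) f (fun j x => u j && q j x)
          (fun j hj => by
            have : u j = true := (List.mem_filter.1 hj).2
            simpa [this] using hq j)
      rw [Finset.sum_add_distrib,
        sum_perm_filter_append (fun L => monoDist (sortList L f)) u] at hstep
      simp only [Finset.sum_const, Finset.card_univ, nsmul_eq_mul, ← hP] at hstep
      simp only [hXdef, hTdef, Fintype.card_fin]
      rw [Finset.sum_comm]
      simp only [Finset.sum_sub_distrib, Finset.sum_const, Finset.card_univ, nsmul_eq_mul, ← hP,
        Fintype.card_fun, Fintype.card_bool, Fintype.card_fin, List.filter_filter] at hstep ⊢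
      push_cast at hstep ⊢
      simp only [Bool.and_comm (u _)] at hstep ⊢
      linarith) (fun _ => true)
  have h0 : ∀ σ : Equiv.Perm (Fin d),
      monoDist (sortList (((List.finRange d).map σ).filter fun _ => true) f) ≤ 0 := fun σ =>
    monoDist_le_zero fun i => monoDir_sortList (by simpa using σ.surjective i) f
  have h1 : P * monoDist f ≤ X fun _ => true := by
    simp only [hXdef, Finset.sum_sub_distrib, Finset.sum_const, Finset.card_univ, nsmul_eq_mul,
      ← hP]
    have := Finset.sum_nonpos fun σ (_ : σ ∈ Finset.univ) => h0 σ
    linarith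
  have h2 := h1.trans main
  simp only [hTdef, Bool.true_and] at h2
  refine le_of_mul_le_mul_left ?_ hPpos
  linarith

end Tracker

section Matching

open Relation

variable {α : Type*}

/-- Along a path from `b` to `a` one can find a permutation which sends `a` to `b` and which
otherwise only moves points along `R`. -/
theorem exists_perm_of_reflTransGen [Finite α] {R : α → α → Prop} {a b : α}
    (h : ReflTransGen R b a) :
    ∃ τ : Equiv.Perm α, τ a = b ∧ ∀ x, x ≠ a → τ x = x ∨ R x (τ x) := by
  classical
  let Z : Set (Set α) := {S | a ∈ S ∧ ∀ b ∈ S, ∃ τ : Equiv.Perm α, τ a = b ∧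
    (∀ x, x ≠ a → τ x = x ∨ R x (τ x)) ∧ ∀ x, x ∉ S → τ x = x}
  have hZ : {a} ∈ Z := ⟨rfl, fun b hb => ⟨1, hb.symm, fun x _ => Or.inl rfl, fun x _ => rfl⟩⟩
  obtain ⟨S, hS, hmax⟩ := (Set.toFinite Z).exists_maximal ⟨_, hZ⟩
  have hb : b ∈ S := by
    induction h using ReflTransGen.head_induction_on with
    | refl => exact hS.1
    | @head b c hbc _ hc =>
      by_contra hbS
      refine hbS (hmax (y := insert b S) ⟨Or.inr hS.1, ?_⟩ (Set.subset_insert b S)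
        (Set.mem_insert b S))
      rintro e (rfl | he)
      · obtain ⟨τ, h1, h2, h3⟩ := hS.2 c hc
        have hea : e ≠ a := fun h => hbS (h ▸ hS.1)
        have hec : e ≠ c := fun h => hbS (h ▸ hc)
        have key : ∀ x, x ≠ a → x ≠ e → (Equiv.swap e c * τ) x = τ x := fun x hxa hxe =>
          Equiv.swap_apply_of_ne_of_ne (fun h => hxe (τ.injective (h.trans (h3 e hbS).symm)))
            (fun h => hxa (τ.injective (h.trans h1.symm)))
        refine ⟨Equiv.swap e c * τ, by simp [h1], fun x hx => ?_, fun x hx => ?_⟩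
        · by_cases hxe : x = e
          · subst hxe
            simp [h3 x hbS, hbc]
          · rw [key x hx hxe]
            exact h2 x hx
        · rw [key x (fun h => hx (h ▸ Or.inr hS.1)) fun h => hx (Or.inl h)]
          exact h3 x fun h => hx (Or.inr h)
      · obtain ⟨τ, h1, h2, h3⟩ := hS.2 e he
        exact ⟨τ, h1, h2, fun x hx => h3 x fun h => hx (Or.inr h)⟩
  obtain ⟨τ, h1, h2, -⟩ := hS.2 b hb
  exact ⟨τ, h1, h2⟩

variable [Preorder α]

open Classical in
/-- The weight of matching `x` to `y`: positive exactly if `x ≤ y` and `r` decreases. -/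
noncomputable def matchWeight (r : α → ℤ) (x y : α) : ℤ :=
  if x ≤ y ∧ r y < r x then 2 * (r x - r y) - 1 else 0

/-- The permutation `π` moves `x` upwards, to a point at which `r` is smaller. -/
def IsDescent (r : α → ℤ) (π : Equiv.Perm α) (x : α) : Prop := x ≤ π x ∧ r (π x) < r x

/-- Both `a` and `b` are descents and `a` lies below the partner of `b`. -/
def CrossLE (r : α → ℤ) (π : Equiv.Perm α) (a b : α) : Prop :=
  IsDescent r π a ∧ IsDescent r π b ∧ a ≤ π b

theorem matchWeight_nonneg (r : α → ℤ) (x y : α) : 0 ≤ matchWeight r x y := by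
  unfold matchWeight
  split_ifs <;> omega

theorem le_matchWeight (r : α → ℤ) {x y : α} (h : x ≤ y) :
    2 * (r x - r y) - 1 ≤ matchWeight r x y := by
  unfold matchWeight
  split_ifs with h1
  · exact le_rfl
  · have : ¬ r y < r x := fun h2 => h1 ⟨h, h2⟩
    omega

theorem IsDescent.matchWeight_eq {r : α → ℤ} {π : Equiv.Perm α} {x : α} (h : IsDescent r π x) :
    matchWeight r x (π x) = 2 * (r x - r (π x)) - 1 := if_pos h

theorem matchWeight_eq_zero {r : α → ℤ} {π : Equiv.Perm α} {x : α} (h : ¬ IsDescent r π x) :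
    matchWeight r x (π x) = 0 := if_neg h

/-- Two descents are linked if they are mutually reachable. -/
def CrossLinked (r : α → ℤ) (π : Equiv.Perm α) (a b : α) : Prop :=
  ReflTransGen (CrossLE r π) a b ∧ ReflTransGen (CrossLE r π) b a

theorem CrossLinked.symm {r : α → ℤ} {π : Equiv.Perm α} {a b : α} (h : CrossLinked r π a b) :
    CrossLinked r π b a := ⟨h.2, h.1⟩

theorem CrossLinked.trans {r : α → ℤ} {π : Equiv.Perm α} {a b c : α} (h : CrossLinked r π a b)
    (h' : CrossLinked r π b c) : CrossLinked r π a c := ⟨h.1.trans h'.1, h'.2.trans h.2⟩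

/-- The points between an element of `K` and the partner of an element of `K`. -/
def InHull (π : Equiv.Perm α) (K : Finset α) (z : α) : Prop :=
  ∃ s ∈ K, ∃ t ∈ K, s ≤ z ∧ z ≤ π t

open Classical in
/-- The Boolean function attached to a class of descents: inside the hull it is the indicator of
the points with `r` above that of all partners that lie above, outside it is monotone. -/
noncomputable def hullFun (r : α → ℤ) (π : Equiv.Perm α) (K : Finset α) (z : α) : Bool :=
  decide (if InHull π K z then ∀ t ∈ K, z ≤ π t → r (π t) < r z else ∃ s ∈ K, s ≤ z)

theorem inHull_and_lt_of_hullFun {r : α → ℤ} {π : Equiv.Perm α} {K : Finset α} {x y : α}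
    (hxy : x ≤ y) (hx : hullFun r π K x = true) (hy : hullFun r π K y = false) :
    InHull π K x ∧ r y < r x := by
  simp only [hullFun, decide_eq_true_eq, decide_eq_false_iff_not] at hx hy
  by_cases hyH : InHull π K y
  · obtain ⟨s', hs', t', ht', hsy', hyt'⟩ := id hyH
    have hxH : InHull π K x := by
      by_contra hxH
      rw [if_neg hxH] at hx
      obtain ⟨s, hs, hsx⟩ := hx
      exact hxH ⟨s, hs, t', ht', hsx, hxy.trans hyt'⟩
    rw [if_pos hxH] at hx
    rw [if_pos hyH] at hy
    push Not at hy
    obtain ⟨t, ht, hyt, hr⟩ := hy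
    exact ⟨hxH, hr.trans_lt (hx t ht (hxy.trans hyt))⟩
  · rw [if_neg hyH] at hy
    refine absurd ?_ hy
    split_ifs at hx with hxH
    · obtain ⟨s, hs, t, ht, hsx, hxt⟩ := hxH
      exact ⟨s, hs, hsx.trans hxy⟩
    · obtain ⟨s, hs, hsx⟩ := hx
      exact ⟨s, hs, hsx.trans hxy⟩

variable [Fintype α]

/-- A maximum weight matching. -/
def IsMaxMatching (r : α → ℤ) (π : Equiv.Perm α) : Prop :=
  ∀ σ : Equiv.Perm α, ∑ x, matchWeight r x (σ x) ≤ ∑ x, matchWeight r x (π x)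

theorem exists_isMaxMatching (r : α → ℤ) : ∃ π : Equiv.Perm α, IsMaxMatching r π :=
  Finite.exists_max fun π : Equiv.Perm α => ∑ x, matchWeight r x (π x)

theorem IsMaxMatching.isDescent_or {r : α → ℤ} {π : Equiv.Perm α} (hπ : IsMaxMatching r π)
    {x y : α} (hxy : x ≤ y) (hr : r y < r x) : IsDescent r π x ∨ IsDescent r π (π.symm y) := by
  classical
  by_contra! h
  have hx : matchWeight r x (π x) = 0 := matchWeight_eq_zero h.1
  have hy : matchWeight r (π.symm y) (π (π.symm y)) = 0 := matchWeight_eq_zero h.2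
  have hxy' : 0 < matchWeight r x y := by
    have := le_matchWeight r hxy
    omega
  refine (hπ (π * Equiv.swap x (π.symm y))).not_gt
    (Finset.sum_lt_sum (fun z _ => ?_) ⟨x, Finset.mem_univ x, ?_⟩)
  · by_cases h1 : z = x
    · rw [h1, hx]; exact matchWeight_nonneg _ _ _
    · by_cases h2 : z = π.symm y
      · rw [h2, hy]; exact matchWeight_nonneg _ _ _
      · rw [Equiv.Perm.mul_apply, Equiv.swap_apply_of_ne_of_ne h1 h2]
  · simpa [hx] using hxy'

theorem IsMaxMatching.lt_of_crossLE {r : α → ℤ} {π : Equiv.Perm α} (hπ : IsMaxMatching r π)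
    {a b : α} (hab : CrossLE r π a b) (hba : ReflTransGen (CrossLE r π) b a) :
    r (π b) < r a := by
  by_contra! hr
  obtain ⟨τ, hτ, h⟩ := exists_perm_of_reflTransGen hba
  have hle : ∀ x, matchWeight r x (π x) + 2 * (r (π x) - r (π (τ x))) ≤
      matchWeight r x (π (τ x)) := by
    intro x
    have h' : τ x = x ∨ CrossLE r π x (τ x) := by
      by_cases hx : x = a
      · subst hx; exact Or.inr (hτ.symm ▸ hab)
      · exact h x hx
    rcases h' with e | ⟨h1, -, h3⟩
    · simp [e]
    · have := le_matchWeight r h3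
      rw [h1.matchWeight_eq]
      omega
  have hlt : matchWeight r a (π a) + 2 * (r (π a) - r (π (τ a))) < matchWeight r a (π (τ a)) := by
    have := matchWeight_nonneg r a (π (τ a))
    rw [hab.1.matchWeight_eq, hτ] at *
    omega
  have hsum := Finset.sum_lt_sum (fun x (_ : x ∈ Finset.univ) => hle x) ⟨a, Finset.mem_univ a, hlt⟩
  rw [Finset.sum_add_distrib, ← Finset.mul_sum, Finset.sum_sub_distrib,
    Equiv.sum_comp τ fun x => r (π x), sub_self, mul_zero, add_zero] at hsum
  exact (hπ (π * τ)).not_gt hsum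

open Classical in
/-- The descents linked to `a`. -/
noncomputable def linkClass (r : α → ℤ) (π : Equiv.Perm α) (a : α) : Finset α :=
  Finset.univ.filter fun b => IsDescent r π b ∧ CrossLinked r π a b

theorem mem_linkClass {r : α → ℤ} {π : Equiv.Perm α} {a b : α} :
    b ∈ linkClass r π a ↔ IsDescent r π b ∧ CrossLinked r π a b := by
  simp [linkClass]

theorem linkClass_eq_of_crossLinked {r : α → ℤ} {π : Equiv.Perm α} {a b : α}
    (h : CrossLinked r π a b) : linkClass r π a = linkClass r π b := by
  ext c
  rw [mem_linkClass, mem_linkClass]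
  exact and_congr_right fun _ => ⟨h.symm.trans, h.trans⟩

theorem IsMaxMatching.lt_of_mem_linkClass {r : α → ℤ} {π : Equiv.Perm α}
    (hπ : IsMaxMatching r π) {a s t : α} (hs : s ∈ linkClass r π a) (ht : t ∈ linkClass r π a)
    (hst : s ≤ π t) : r (π t) < r s := by
  rw [mem_linkClass] at hs ht
  exact hπ.lt_of_crossLE ⟨hs.1, ht.1, hst⟩ (ht.2.symm.trans hs.2).1

theorem linkClass_eq_of_inHull {r : α → ℤ} {π : Equiv.Perm α} {a b z : α}
    (ha : InHull π (linkClass r π a) z) (hb : InHull π (linkClass r π b) z) :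
    linkClass r π a = linkClass r π b := by
  obtain ⟨s, hs, t, ht, hsz, hzt⟩ := ha
  obtain ⟨s', hs', t', ht', hsz', hzt'⟩ := hb
  rw [mem_linkClass] at hs ht hs' ht'
  refine linkClass_eq_of_crossLinked ⟨?_, ?_⟩
  · exact (hs.2.1.tail ⟨hs.1, ht'.1, hsz.trans hzt'⟩).trans ht'.2.2
  · exact (hs'.2.1.tail ⟨hs'.1, ht.1, hsz'.trans hzt⟩).trans ht.2.2

theorem IsMaxMatching.hullFun_eq_true {r : α → ℤ} {π : Equiv.Perm α} (hπ : IsMaxMatching r π)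
    {a s : α} (hs : s ∈ linkClass r π a) : hullFun r π (linkClass r π a) s = true := by
  have : InHull π (linkClass r π a) s := ⟨s, hs, s, hs, le_rfl, (mem_linkClass.1 hs).1.1⟩
  simp only [hullFun, decide_eq_true_eq, if_pos this]
  exact fun t ht hst => hπ.lt_of_mem_linkClass hs ht hst

theorem hullFun_eq_false {r : α → ℤ} {π : Equiv.Perm α}
    {a s : α} (hs : s ∈ linkClass r π a) : hullFun r π (linkClass r π a) (π s) = false := by
  have : InHull π (linkClass r π a) (π s) := ⟨s, hs, s, hs, (mem_linkClass.1 hs).1.1, le_rfl⟩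
  simp only [hullFun, decide_eq_false_iff_not, if_pos this]
  exact fun h => (h s hs le_rfl).false

end Matching

section Extension

variable {α β : Type*} [Preorder α] [Fintype α] [LinearOrder β]

/-- A function which is monotone off a set `W` agrees off `W` with a monotone function. -/
theorem exists_monotone_eq_off [Nonempty α] (f : α → β) (W : Set α)
    (hW : ∀ x ∉ W, ∀ y ∉ W, x ≤ y → f x ≤ f y) :
    ∃ g : α → β, Monotone g ∧ ∀ x ∉ W, g x = f x := by
  classical
  obtain ⟨m, hm⟩ := Finite.exists_min f
  have hne : ∀ x : α, (insert (f m)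
      ((Finset.univ.filter fun y => y ≤ x ∧ y ∉ W).image f)).Nonempty := fun x =>
    Finset.insert_nonempty _ _
  refine ⟨fun x => (insert (f m) ((Finset.univ.filter fun y => y ≤ x ∧ y ∉ W).image f)).max'
    (hne x), fun x y hxy => ?_, fun x hx => le_antisymm ?_ ?_⟩
  · refine Finset.max'_subset _ (Finset.insert_subset_insert _ (Finset.image_subset_image ?_))
    exact fun z hz => by
      simp only [Finset.mem_filter, Finset.mem_univ, true_and] at hz ⊢
      exact ⟨hz.1.trans hxy, hz.2⟩
  · refine Finset.max'_le _ _ _ fun b hb => ?_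
    simp only [Finset.mem_insert, Finset.mem_image, Finset.mem_filter, Finset.mem_univ,
      true_and] at hb
    rcases hb with rfl | ⟨y, ⟨hyx, hy⟩, rfl⟩
    · exact hm x
    · exact hW y hy x hx hyx
  · refine Finset.le_max' _ _ (Finset.mem_insert_of_mem (Finset.mem_image_of_mem f ?_))
    simp [hx]

end Extension

section Cube

variable {d : ℕ}

theorem eq_true_of_le_of_monoDir {ι : Type*} [Fintype ι] [DecidableEq ι]
    {k : (ι → Bool) → Bool} (hk : ∀ i, MonoDir i k) {x y : ι → Bool} (hxy : x ≤ y)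
    (hx : k x = true) : k y = true := by
  have key : ∀ s : Finset ι, k (fun i => if i ∈ s then y i else x i) = true := by
    intro s
    induction s using Finset.induction_on with
    | empty => simpa using hx
    | insert i s hi ih =>
      by_cases e : x i = y i
      · convert ih using 2
        ext j
        by_cases hj : j = i
        · subst hj; simp [hi, e]
        · simp [hj]
      · have hle := hxy i
        have hxi : x i = false := by
          by_contra hne
          rw [Bool.not_eq_false] at hne
          exact e (le_antisymm hle (hne ▸ Bool.le_true _))
        have hyi : y i = true := by
          cases h2 : y i <;> simp_all
        have := hk i _ (by simp [hi, hxi]) ih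
        convert this using 2
        ext j
        by_cases hj : j = i
        · subst hj; simp [hi, hxi, hyi]
        · simp [hj, flipAt_of_ne hj]
  simpa using key Finset.univ

theorem le_flipAt {ι : Type*} [DecidableEq ι] {x : ι → Bool} {j : ι} (hx : x j = false) :
    x ≤ flipAt j x := by
  intro i
  by_cases h : i = j
  · subst h; simp [hx]
  · rw [flipAt_of_ne h]

theorem card_le_monoDist {ι : Type*} [Fintype ι] [DecidableEq ι] {h : (ι → Bool) → Bool}
    {π : Equiv.Perm (ι → Bool)} {K : Finset (ι → Bool)} (hle : ∀ s ∈ K, s ≤ π s)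
    (h1 : ∀ s ∈ K, h s = true) (h0 : ∀ s ∈ K, h (π s) = false) : (K.card : ℝ) ≤ monoDist h := by
  obtain ⟨k, hk, e⟩ := exists_monoDist_eq h
  have hD : hamDist h k = ((Finset.univ.filter fun x => h x ≠ k x).card : ℝ) := by
    simp [hamDist, Finset.sum_ite]
  rw [← e, hD]
  refine Nat.cast_le.2 (Finset.card_le_card_of_injOn (fun s => if k s then π s else s) ?_ ?_)
  · intro s hs
    have hs' : s ∈ K := hs
    simp only [Finset.coe_filter, Finset.mem_univ, true_and, Set.mem_ofPred_eq]
    split_ifs with hks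
    · rw [h0 s hs', eq_true_of_le_of_monoDir hk (hle s hs') hks]; simp
    · rw [h1 s hs']; simpa using hks
  · intro s hs t ht hst
    have hs' : s ∈ K := hs
    have ht' : t ∈ K := ht
    have a1 := h1 s hs'
    have a2 := h1 t ht'
    have a3 := h0 s hs'
    have a4 := h0 t ht'
    simp only at hst
    split_ifs at hst with h5 h6 h6
    · exact π.injective hst
    · rw [hst, a2] at a3; simp at a3
    · rw [hst, a4] at a1; simp at a1
    · exact hst

theorem card_filter_le_outViol (f : (Fin d → Bool) → ℝ) (x : Fin d → Bool) :
    (Finset.univ.filter fun j : Fin d => x j = false ∧ f (flipAt j x) < f x).card ≤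
      outViol d f x := by
  classical
  rw [outViol, Nat.card_eq_fintype_card, Fintype.card_subtype]
  refine Finset.card_le_card_of_injOn (fun j => flipAt j x) ?_ ?_
  · intro j hj
    have hj' : x j = false ∧ f (flipAt j x) < f x := by simpa using hj
    simp only [Finset.coe_filter, Finset.mem_univ, true_and, Set.mem_ofPred_eq]
    exact ⟨⟨j, hj'.1, by simp [hj'.1], fun i hi => (flipAt_of_ne hi x).symm⟩, hj'.2⟩
  · intro i _ j _ hij
    by_contra hne
    have h1 := congrFun (show flipAt i x = flipAt j x from hij) i
    rw [flipAt_same, flipAt_of_ne hne] at h1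
    simp at h1

/-- A real-valued function on a finite type induces the same strict order as an integer-valued
one. -/
theorem exists_rank {α : Type*} [Fintype α] (f : α → ℝ) :
    ∃ r : α → ℤ, ∀ x y, r x < r y ↔ f x < f y := by
  classical
  have hlt : ∀ x y, f x < f y → (Finset.univ.filter fun z => f z < f x).card <
      (Finset.univ.filter fun z => f z < f y).card := fun x y h =>
    Finset.card_lt_card (Finset.ssubset_iff_of_subset (fun z hz => by
      simp only [Finset.mem_filter, Finset.mem_univ, true_and] at hz ⊢
      exact hz.trans h) |>.2 ⟨x, by simp [h], by simp⟩)
  refine ⟨fun x => (Finset.univ.filter fun z => f z < f x).card, fun x y => ?_⟩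
  refine ⟨fun h => ?_, fun h => Nat.cast_lt.2 (hlt x y h)⟩
  replace h := Nat.cast_lt.1 h
  by_contra! hyx
  rcases hyx.lt_or_eq with h' | h'
  · have := hlt y x h'
    omega
  · simp [h'] at h

theorem sum_sqrt_chargeCount_hullFun_le {f : (Fin d → Bool) → ℝ} {r : (Fin d → Bool) → ℤ}
    (hr : ∀ x y, r x < r y ↔ f x < f y) (π : Equiv.Perm (Fin d → Bool)) (x : Fin d → Bool)
    (S : Finset (Finset (Fin d → Bool)))
    (hS : ∀ K ∈ S, ∀ L ∈ S, InHull π K x → InHull π L x → K = L) :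
    ∑ K ∈ S, √(chargeCount (fun j z => !z j && hullFun r π K z && !hullFun r π K (flipAt j z)) x) ≤
      √(outViol d f x) := by
  have hviol : ∀ K, ∀ j : Fin d,
      (!x j && hullFun r π K x && !hullFun r π K (flipAt j x)) = true →
      InHull π K x ∧ x j = false ∧ f (flipAt j x) < f x := by
    intro K j h
    simp only [Bool.and_eq_true, Bool.not_eq_true'] at h
    have := inHull_and_lt_of_hullFun (le_flipAt h.1.1) h.1.2 h.2
    exact ⟨this.1, h.1.1, (hr _ _).1 this.2⟩
  have hzero : ∀ K, ¬ InHull π K x →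
      √(chargeCount (fun j z => !z j && hullFun r π K z && !hullFun r π K (flipAt j z)) x) = 0 := by
    intro K hK
    rw [Real.sqrt_eq_zero']
    refine (Finset.sum_eq_zero fun j _ => if_neg fun h => hK (hviol K j h).1).le
  by_cases hex : ∃ K ∈ S, InHull π K x
  · obtain ⟨K, hK, hKx⟩ := hex
    rw [Finset.sum_eq_single_of_mem K hK fun L hL hne => hzero L fun hLx =>
      hne (hS L hL K hK hLx hKx)]
    refine Real.sqrt_le_sqrt ?_
    refine le_trans ?_ (Nat.cast_le.2 (card_filter_le_outViol f x))
    rw [Finset.card_filter]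
    push_cast
    refine Finset.sum_le_sum fun j _ => ?_
    split_ifs with h1 h2 h2
    · exact le_rfl
    · exact absurd (hviol K j h1).2 h2
    · exact zero_le_one
    · exact le_rfl
  · push Not at hex
    rw [Finset.sum_eq_zero fun K hK => hzero K (hex K hK)]
    exact Real.sqrt_nonneg _

open Classical in
theorem card_isDescent_le {f : (Fin d → Bool) → ℝ} {r : (Fin d → Bool) → ℤ}
    (hr : ∀ x y, r x < r y ↔ f x < f y) {π : Equiv.Perm (Fin d → Bool)}
    (hπ : IsMaxMatching r π) :
    ((Finset.univ.filter (IsDescent r π)).card : ℝ) ≤ 32 * ∑ x, √(outViol d f x) := by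
  set P := Finset.univ.filter (IsDescent r π) with hP
  set S := P.image (linkClass r π) with hS
  have hcard : P.card = ∑ K ∈ S, K.card := by
    rw [Finset.card_eq_sum_card_image (linkClass r π) P]
    refine Finset.sum_congr rfl fun K hK => congrArg _ ?_
    obtain ⟨a, ha, rfl⟩ := Finset.mem_image.1 hK
    ext b
    rw [Finset.mem_filter, hP, Finset.mem_filter, mem_linkClass]
    refine ⟨fun h => ?_, fun h => ⟨⟨Finset.mem_univ b, h.1⟩, (linkClass_eq_of_crossLinked h.2).symm⟩⟩
    have : b ∈ linkClass r π b := mem_linkClass.2 ⟨h.1.2, .refl, .refl⟩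
    rw [h.2] at this
    exact mem_linkClass.1 this
  have hstep : ∀ K ∈ S, (K.card : ℝ) ≤ 32 * ∑ x, √(chargeCount (fun j z =>
      !z j && hullFun r π K z && !hullFun r π K (flipAt j z)) x) := by
    intro K hK
    obtain ⟨a, -, rfl⟩ := Finset.mem_image.1 hK
    refine (card_le_monoDist (π := π) (fun s hs => (mem_linkClass.1 hs).1.1)
      (fun s hs => hπ.hullFun_eq_true hs) fun s hs => hullFun_eq_false hs).trans
      (monoDist_le_sum_sqrt _ _ fun j x h1 h2 h3 => ?_)
    simp [h1, h2, h3]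
  rw [hcard]
  push_cast
  refine (Finset.sum_le_sum hstep).trans ?_
  rw [← Finset.mul_sum, Finset.sum_comm]
  refine mul_le_mul_of_nonneg_left (Finset.sum_le_sum fun x _ =>
    sum_sqrt_chargeCount_hullFun_le hr π x S ?_) (by norm_num)
  intro K hK L hL hKx hLx
  obtain ⟨a, -, rfl⟩ := Finset.mem_image.1 hK
  obtain ⟨b, -, rfl⟩ := Finset.mem_image.1 hL
  exact linkClass_eq_of_inHull hKx hLx

open Classical in
theorem distMono_mul_le {f : (Fin d → Bool) → ℝ} {r : (Fin d → Bool) → ℤ}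
    (hr : ∀ x y, r x < r y ↔ f x < f y) {π : Equiv.Perm (Fin d → Bool)}
    (hπ : IsMaxMatching r π) :
    distMono d f * 2 ^ d ≤ 2 * ((Finset.univ.filter (IsDescent r π)).card : ℝ) := by
  set P := Finset.univ.filter (IsDescent r π) with hP
  set W := P ∪ P.image π with hWdef
  obtain ⟨g, hg, hgf⟩ := exists_monotone_eq_off f (W : Set (Fin d → Bool)) (by
    intro x hx y hy hxy
    by_contra! hlt
    rcases hπ.isDescent_or hxy ((hr _ _).2 hlt) with h | h
    · exact hx (by simp [hWdef, hP, h])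
    · refine hy (Finset.mem_coe.2 (Finset.mem_union_right _ (Finset.mem_image.2
        ⟨π.symm y, by simp [hP, h], by simp⟩))))
  have hle : sInf {n : ℕ | ∃ g : (Fin d → Bool) → ℝ, MonotoneCube g ∧
      n = Nat.card {x : Fin d → Bool // f x ≠ g x}} ≤ 2 * P.card := by
    have hmem : Nat.card {x : Fin d → Bool // f x ≠ g x} ∈ {n : ℕ | ∃ g : (Fin d → Bool) → ℝ,
        MonotoneCube g ∧ n = Nat.card {x : Fin d → Bool // f x ≠ g x}} :=
      ⟨g, fun x y hxy => hg hxy, rfl⟩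
    refine (Nat.sInf_le hmem).trans ?_
    rw [Nat.card_eq_fintype_card, Fintype.card_subtype]
    calc _ ≤ W.card := Finset.card_le_card fun x hx => by
          by_contra hxW
          exact (Finset.mem_filter.1 hx).2 (hgf x (by simpa using hxW)).symm
      _ ≤ P.card + (P.image π).card := Finset.card_union_le _ _
      _ ≤ 2 * P.card := by
          have := Finset.card_image_le (s := P) (f := π)
          omega
  rw [distMono, div_mul_cancel₀ _ (by positivity)]
  exact_mod_cast hle

end Cube

/-- Isoperimetric inequality for real-valued functions (generalized KMS inequality). -/
theorem directed_talagrand_real :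
    ∃ C : ℝ, 0 < C ∧ ∀ d : ℕ, 1 ≤ d → ∀ f : (Fin d → Bool) → ℝ,
      (∑ x : Fin d → Bool, Real.sqrt (outViol d f x)) / 2 ^ d ≥ C * distMono d f := by
  refine ⟨1 / 64, by norm_num, fun d _ f => ?_⟩
  obtain ⟨r, hr⟩ := exists_rank f
  obtain ⟨π, hπ⟩ := exists_isMaxMatching r
  have h1 := card_isDescent_le hr hπ
  have h2 := distMono_mul_le hr hπ
  rw [ge_iff_le, le_div_iff₀ (by positivity)]
  linarith
end

section
/- For every dimension d ≥ 1 and every function f : {0,1}^d → ℝ, the expectation over a uniformly random x ∈ {0,1}^d of sqrt(I_f(x)) is at least dist(f, const) / (2√2); that is, (1/2^d) · Σ_{x ∈ {0,1}^d} sqrt(I_f(x)) ≥ dist(f, const) / (2√2). -/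
/-- Undirected hypercube adjacency: `x` and `y` differ in exactly one coordinate. -/
def Adj {d : ℕ} (x y : Fin d → Bool) : Prop :=
  ∃ i : Fin d, x i ≠ y i ∧ ∀ j : Fin d, j ≠ i → x j = y j

/-- `I_f(x)`: the number of influential edges `{x,y}` incident on `x`
with `f x > f y` (so each influential edge is counted at exactly one endpoint). -/
noncomputable def undirI (d : ℕ) (f : (Fin d → Bool) → ℝ) (x : Fin d → Bool) : ℕ :=
  Nat.card {y : Fin d → Bool // Adj x y ∧ f x > f y}

/-- Distance of `f` to the nearest constant function. -/
noncomputable def distConst (d : ℕ) (f : (Fin d → Bool) → ℝ) : ℝ :=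
  ((sInf {n : ℕ | ∃ c : ℝ, n = Nat.card {x : Fin d → Bool // f x ≠ c}} : ℕ) : ℝ) / 2 ^ d

/-- The number of coordinates whose flip takes `x` from inside the set `g` to outside. -/
noncomputable def boundaryDegree {d : ℕ} (g : (Fin d → Bool) → Bool) (x : Fin d → Bool) : ℝ :=
  ∑ i : Fin d, if g x = true ∧ g (Function.update x i (!x i)) = false then 1 else 0

/-- The number of points of the set `g`. -/
noncomputable def volumeCount {d : ℕ} (g : (Fin d → Bool) → Bool) : ℝ :=
  ∑ x : Fin d → Bool, if g x = true then 1 else 0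

theorem boundaryDegree_nonneg {d : ℕ} (g : (Fin d → Bool) → Bool) (x : Fin d → Bool) :
    0 ≤ boundaryDegree g x :=
  Finset.sum_nonneg fun i _ => by split_ifs <;> norm_num

theorem volumeCount_nonneg {d : ℕ} (g : (Fin d → Bool) → Bool) : 0 ≤ volumeCount g :=
  Finset.sum_nonneg fun i _ => by split_ifs <;> norm_num

theorem volumeCount_le {d : ℕ} (g : (Fin d → Bool) → Bool) : volumeCount g ≤ 2 ^ d := by
  calc volumeCount g ≤ ∑ _x : Fin d → Bool, (1 : ℝ) :=
        Finset.sum_le_sum fun i _ => by split_ifs <;> norm_num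
    _ = 2 ^ d := by simp

theorem sum_cube_succ {d : ℕ} (F : (Fin (d + 1) → Bool) → ℝ) :
    ∑ x, F x = ∑ x : Fin d → Bool, F (Fin.cons true x) + ∑ x : Fin d → Bool, F (Fin.cons false x) := by
  rw [← (Fin.consEquiv fun _ : Fin (d + 1) => Bool).sum_comp, Fintype.sum_prod_type]
  simp [Fin.consEquiv]

theorem boundaryDegree_cons {d : ℕ} (g : (Fin (d + 1) → Bool) → Bool) (b : Bool)
    (x : Fin d → Bool) :
    boundaryDegree g (Fin.cons b x) = boundaryDegree (fun y => g (Fin.cons b y)) x +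
      if g (Fin.cons b x) = true ∧ g (Fin.cons (!b) x) = false then 1 else 0 := by
  simp only [boundaryDegree, Fin.sum_univ_succ, Fin.cons_zero, Fin.cons_succ,
    Fin.update_cons_zero, ← Fin.cons_update]
  exact add_comm _ _

/-- Minkowski's inequality for the Euclidean norm on the plane. -/
theorem sq_sum_add_sq_sum_le {ι : Type*} (s : Finset ι) (u v : ι → ℝ) :
    (∑ i ∈ s, u i) ^ 2 + (∑ i ∈ s, v i) ^ 2 ≤ (∑ i ∈ s, √(u i ^ 2 + v i ^ 2)) ^ 2 := by
  have h := norm_sum_le s fun i => (⟨u i, v i⟩ : ℂ)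
  have h2 : ∀ z : ℂ, ‖z‖ = √(z.re ^ 2 + z.im ^ 2) := fun z => by
    rw [Complex.norm_def, Complex.normSq_apply, sq, sq]
  simp only [h2, Complex.re_sum, Complex.im_sum] at h
  exact (Real.sqrt_le_left (Finset.sum_nonneg fun i _ => Real.sqrt_nonneg _)).1 h

theorem two_point_inequality {N a b S S' T D : ℝ} (hN : 0 < N) (hb : 0 ≤ b) (hab : b ≤ a)
    (ha : a ≤ N) (hS : √2 * (a * (N - a)) ≤ N * S) (hS' : √2 * (b * (N - b)) ≤ N * S')
    (hT : 0 ≤ T) (hD : a - b ≤ D) (h : S ^ 2 + D ^ 2 ≤ T ^ 2) :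
    √2 * ((a + b) * (2 * N - (a + b))) ≤ 2 * N * (T + S') := by
  have h2 : √2 ^ 2 = 2 := Real.sq_sqrt (by norm_num)
  have hJ : 0 ≤ √2 * (a * (N - a)) := by
    have := sub_nonneg.2 ha
    have := hb.trans hab
    positivity
  suffices key : √2 * (a * (N - a)) + √2 * (a - b) ^ 2 / 2 ≤ N * T by nlinarith
  refine le_of_sq_le_sq ?_ (by positivity)
  have hS2 : (√2 * (a * (N - a))) ^ 2 ≤ (N * S) ^ 2 := by gcongr
  have hD2 : (a - b) ^ 2 ≤ D ^ 2 := by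
    have := sub_nonneg.2 hab
    gcongr
  have hT2 : N ^ 2 * (S ^ 2 + (a - b) ^ 2) ≤ N ^ 2 * T ^ 2 := by
    gcongr
    linarith
  have hquad : 0 ≤ N ^ 2 - 2 * (a * (N - a)) - (a - b) ^ 2 / 2 := by
    nlinarith [sq_nonneg (2 * a - N), sq_nonneg (3 * a - 2 * N), mul_nonneg hb (sub_nonneg.2 hab)]
  have hprod := mul_nonneg (sq_nonneg (a - b)) hquad
  have hexp : (√2 * (a * (N - a)) + √2 * (a - b) ^ 2 / 2) ^ 2 =
      (√2 * (a * (N - a))) ^ 2 + √2 ^ 2 * ((a * (N - a)) * (a - b) ^ 2 + (a - b) ^ 4 / 4) := by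
    ring
  rw [hexp, h2]
  nlinarith

theorem volumeCount_sub_le {d : ℕ} (g g' : (Fin d → Bool) → Bool) :
    volumeCount g - volumeCount g' ≤
      ∑ x, if g x = true ∧ g' x = false then (1 : ℝ) else 0 := by
  rw [volumeCount, volumeCount, ← Finset.sum_sub_distrib]
  refine Finset.sum_le_sum fun x _ => ?_
  cases g x <;> cases g' x <;> simp

theorem sq_sum_sqrt_boundaryDegree_le {d : ℕ} (g : (Fin d → Bool) → Bool)
    (p : (Fin d → Bool) → Prop) [DecidablePred p] :
    (∑ x, √(boundaryDegree g x)) ^ 2 + (∑ x, if p x then (1 : ℝ) else 0) ^ 2 ≤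
      (∑ x, √(boundaryDegree g x + if p x then 1 else 0)) ^ 2 := by
  convert sq_sum_add_sq_sum_le Finset.univ (fun x => √(boundaryDegree g x))
    (fun x => if p x then (1 : ℝ) else 0) using 5 with x
  rw [Real.sq_sqrt (boundaryDegree_nonneg g x)]
  split_ifs <;> norm_num

/-- One-sided Talagrand inequality for subsets of the cube. -/
theorem sqrt_two_mul_volumeCount_le {d : ℕ} (g : (Fin d → Bool) → Bool) :
    √2 * (volumeCount g * (2 ^ d - volumeCount g)) ≤ 2 ^ d * ∑ x, √(boundaryDegree g x) := by
  induction d with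
  | zero =>
    simp only [volumeCount, boundaryDegree, Fintype.sum_unique]
    split_ifs <;> simp
  | succ d ih =>
    have slices (b : Bool) (hle : volumeCount (fun y => g (Fin.cons (!b) y)) ≤
        volumeCount (fun y => g (Fin.cons b y))) :=
      two_point_inequality (by positivity : (0 : ℝ) < 2 ^ d) (volumeCount_nonneg _) hle
        (volumeCount_le _) (ih _) (ih _)
        (Finset.sum_nonneg fun x _ => Real.sqrt_nonneg _) (volumeCount_sub_le _ _)
        (sq_sum_sqrt_boundaryDegree_le _ _)
    have mono (b : Bool) : ∑ x, √(boundaryDegree (fun y => g (Fin.cons b y)) x) ≤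
        ∑ x, √(boundaryDegree g (Fin.cons b x)) := by
      refine Finset.sum_le_sum fun x _ => Real.sqrt_le_sqrt ?_
      rw [boundaryDegree_cons]
      split_ifs <;> linarith
    have hvol : volumeCount g = volumeCount (fun y => g (Fin.cons true y)) +
        volumeCount (fun y => g (Fin.cons false y)) := sum_cube_succ _
    rw [sum_cube_succ, hvol, pow_succ']
    simp only [← boundaryDegree_cons] at slices
    have hpos : (0 : ℝ) < 2 * 2 ^ d := by positivity
    rcases le_total (volumeCount fun y => g (Fin.cons false y))
      (volumeCount fun y => g (Fin.cons true y)) with hle | hle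
    · refine (slices true hle).trans ?_
      exact mul_le_mul_of_nonneg_left (add_le_add_right (mono false) _) hpos.le
    · have h := slices false hle
      rw [add_comm (volumeCount fun y => g (Fin.cons true y)),
        add_comm (∑ x, √(boundaryDegree g (Fin.cons true x)))]
      refine h.trans ?_
      exact mul_le_mul_of_nonneg_left (add_le_add_right (mono true) _) hpos.le

theorem boundaryDegree_le_undirI {d : ℕ} {f : (Fin d → Bool) → ℝ} {g : (Fin d → Bool) → Bool}
    (hg : ∀ x y, g x = true → g y = false → f y < f x) (x : Fin d → Bool) :
    boundaryDegree g x ≤ undirI d f x := by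
  rw [boundaryDegree, Finset.sum_boole, undirI, Nat.cast_le, ← Fintype.card_subtype,
    ← Nat.card_eq_fintype_card]
  refine Nat.card_le_card_of_injective (fun i => ⟨Function.update x i.1 (!x i.1),
    ⟨i.1, by simp, fun j hj => by simp [hj]⟩, hg _ _ i.2.1 i.2.2⟩) ?_
  intro i j hij
  have h := congrFun (congrArg Subtype.val hij) i.1
  by_contra hne
  have hne' : i.1 ≠ j.1 := fun h => hne (Subtype.ext h)
  simp [hne'] at h

theorem exists_median {α : Type*} [Fintype α] [Nonempty α] (f : α → ℝ) :
    ∃ t, 2 * Fintype.card {x // f x < t} ≤ Fintype.card α ∧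
      2 * Fintype.card {x // t < f x} ≤ Fintype.card α := by
  classical
  simp only [Fintype.card_subtype]
  let s : Finset α := {a | Fintype.card α ≤ 2 * Finset.card {x | f x ≤ f a}}
  have hs : s.Nonempty := by
    obtain ⟨m, -, hm⟩ := Finset.exists_max_image Finset.univ f Finset.univ_nonempty
    refine ⟨m, ?_⟩
    have : Finset.filter (fun x => f x ≤ f m) Finset.univ = Finset.univ :=
      Finset.filter_true_of_mem hm
    simp [s, this, Finset.card_univ]
    omega
  obtain ⟨a, ha, hmin⟩ := Finset.exists_min_image s f hs
  refine ⟨f a, ?_, ?_⟩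
  · by_contra! hlt
    have hne : (Finset.univ.filter fun x => f x < f a).Nonempty := by
      rw [← Finset.card_pos]
      omega
    obtain ⟨b, hb, hmax⟩ := Finset.exists_max_image _ f hne
    have hsub : Finset.univ.filter (fun x => f x < f a) ⊆ Finset.univ.filter fun x => f x ≤ f b :=
      fun x hx => by simpa using hmax x hx
    have hbs : b ∈ s := by
      have := Finset.card_le_card hsub
      simp only [s, Finset.mem_filter_univ]
      omega
    exact absurd (hmin b hbs) (not_le.2 (by simpa using hb))
  · have hsum := Finset.card_filter_add_card_filter_not (s := Finset.univ) fun x => f x ≤ f a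
    simp only [s, Finset.mem_filter_univ] at ha
    simp only [not_le, Finset.card_univ] at hsum
    omega

theorem sqrt_two_mul_le_sum_sqrt_undirI {d : ℕ} {f : (Fin d → Bool) → ℝ}
    {g : (Fin d → Bool) → Bool} (hg : ∀ x y, g x = true → g y = false → f y < f x) {n : ℝ}
    (hn : n / 2 * (2 ^ d / 2) ≤ volumeCount g * (2 ^ d - volumeCount g)) :
    √2 * n / 4 ≤ ∑ x, √(undirI d f x : ℝ) := by
  have h := sqrt_two_mul_volumeCount_le g
  have hmono : ∑ x, √(boundaryDegree g x) ≤ ∑ x, √(undirI d f x : ℝ) :=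
    Finset.sum_le_sum fun x _ => Real.sqrt_le_sqrt (boundaryDegree_le_undirI hg x)
  have hN : (0 : ℝ) < 2 ^ d := by positivity
  have h' := mul_le_mul_of_nonneg_left hn (Real.sqrt_nonneg 2)
  refine le_trans (le_of_mul_le_mul_left ?_ hN) hmono
  linarith

/-- Undirected isoperimetric (Talagrand) inequality for real-valued functions. -/
theorem undirected_talagrand_real (d : ℕ) (hd : 1 ≤ d) (f : (Fin d → Bool) → ℝ) :
    (∑ x : Fin d → Bool, Real.sqrt (undirI d f x)) / 2 ^ d ≥
      distConst d f / (2 * Real.sqrt 2) := by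
  classical
  obtain ⟨t, hlow, hhigh⟩ := exists_median f
  set k := Fintype.card {x // f x < t} with hk
  set l := Fintype.card {x // t < f x} with hl
  have hcard : Fintype.card (Fin d → Bool) = 2 ^ d := by simp
  rw [hcard] at hlow hhigh
  have hlow' : 2 * (k : ℝ) ≤ 2 ^ d := by exact_mod_cast hlow
  have hhigh' : 2 * (l : ℝ) ≤ 2 ^ d := by exact_mod_cast hhigh
  have hne : Nat.card {x // f x ≠ t} = k + l := by
    simp only [Nat.card_eq_fintype_card, hk, hl, Fintype.card_subtype, ne_iff_lt_or_gt,
      Finset.filter_or]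
    refine Finset.card_union_of_disjoint (Finset.disjoint_filter.2 fun x _ h h' => ?_)
    exact lt_asymm h h'
  have hdist : ((sInf {n : ℕ | ∃ c : ℝ, n = Nat.card {x : Fin d → Bool // f x ≠ c}} : ℕ) : ℝ) ≤
      k + l := by
    rw [← Nat.cast_add, Nat.cast_le]
    exact Nat.sInf_le ⟨t, hne.symm⟩
  have hupper : volumeCount (fun x => decide (t < f x)) = l := by
    simp [volumeCount, hl, Fintype.card_subtype]
  have hlower : volumeCount (fun x => decide (t ≤ f x)) = 2 ^ d - k := by
    have hsum := Finset.card_filter_add_card_filter_not (s := Finset.univ) fun x => t ≤ f x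
    simp only [not_le, Finset.card_univ, hcard, ← Fintype.card_subtype] at hsum
    rw [eq_sub_iff_add_eq]
    simp only [volumeCount, decide_eq_true_eq, Finset.sum_boole, ← Fintype.card_subtype]
    exact_mod_cast hsum
  have main : √2 * (k + l) / 4 ≤ ∑ x, √(undirI d f x : ℝ) := by
    rcases le_total k l with hkl | hkl <;> have hkl' := Nat.cast_le (α := ℝ).2 hkl
    · refine sqrt_two_mul_le_sum_sqrt_undirI (g := fun x => decide (t < f x)) ?_ ?_
      · intro x y hx hy
        simp only [decide_eq_true_eq, decide_eq_false_iff_not, not_lt] at hx hy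
        exact hy.trans_lt hx
      · rw [hupper, sub_eq_add_neg]
        apply mul_le_mul <;> first | positivity | linarith
    · refine sqrt_two_mul_le_sum_sqrt_undirI (g := fun x => decide (t ≤ f x)) ?_ ?_
      · intro x y hx hy
        simp only [decide_eq_true_eq, decide_eq_false_iff_not, not_le] at hx hy
        exact hy.trans_le hx
      · rw [hlower, sub_sub_cancel, mul_comm (2 ^ d - (k : ℝ))]
        apply mul_le_mul <;> first | positivity | linarith
  have h2 : √2 * √2 = 2 := Real.mul_self_sqrt (by norm_num)
  rw [ge_iff_le, distConst, div_right_comm]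
  gcongr
  rw [div_le_iff₀ (by positivity)]
  have := mul_le_mul_of_nonneg_right main (by positivity : 0 ≤ 2 * √2)
  nlinarith
end

section
/- For every dimension d ≥ 1 and every function f : {0,1}^d → ℝ, the number of directed hypercube edges violated by f satisfies |S_f^-| ≥ ε(f) · 2^{d-1}. -/
/-- `|S_f^-|`: the total number of violated edges of `f`. -/
noncomputable def totViol (d : ℕ) (f : (Fin d → Bool) → ℝ) : ℕ :=
  Nat.card {p : (Fin d → Bool) × (Fin d → Bool) // IsEdge p.1 p.2 ∧ f p.1 > f p.2}

open Filter Topology in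
/-- A monotone function on the cube stays monotone under a small perturbation whose direction is
monotone along its level sets. -/
lemma MonotoneCube.eventually_sub_mul {d : ℕ} {g k : (Fin d → Bool) → ℝ} (hg : MonotoneCube g)
    (hk : ∀ x y, x ≤ y → g x = g y → k y ≤ k x) :
    ∀ᶠ η in 𝓝[>] (0 : ℝ), MonotoneCube fun x => g x - η * k x := by
  have key : ∀ᶠ η in 𝓝[>] (0 : ℝ), ∀ x y : Fin d → Bool, x ≤ y →
      g x - η * k x ≤ g y - η * k y := by
    refine eventually_all.2 fun x => eventually_all.2 fun y => ?_
    by_cases hxy : x ≤ y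
    · rcases (hg x y hxy).lt_or_eq with hlt | heq
      · have hl : Tendsto (fun η : ℝ => g x - η * k x) (𝓝 0) (𝓝 (g x)) :=
          Continuous.tendsto' (by fun_prop) _ _ (by simp)
        have hr : Tendsto (fun η : ℝ => g y - η * k y) (𝓝 0) (𝓝 (g y)) :=
          Continuous.tendsto' (by fun_prop) _ _ (by simp)
        filter_upwards [nhdsWithin_le_nhds (hl.eventually_lt hr hlt)] with η hη _ using hη.le
      · filter_upwards [self_mem_nhdsWithin] with η hη _
        have := mul_le_mul_of_nonneg_left (hk x y hxy heq) (le_of_lt hη)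
        linarith
    · exact Eventually.of_forall fun η h => absurd h hxy
  filter_upwards [key] with η hη x y hxy using hη x y hxy

/-- Truncation of a real number to `[-1, 1]`, the derivative of the Huber loss. -/
noncomputable def clampUnit (t : ℝ) : ℝ := max (-1) (min 1 t)

/-- The Huber loss: `t ^ 2 / 2` for `|t| ≤ 1` and `|t| - 1 / 2` otherwise. -/
noncomputable def huber (t : ℝ) : ℝ := t * clampUnit t - clampUnit t ^ 2 / 2

lemma clampUnit_cases (t : ℝ) :
    (t ≤ -1 ∧ clampUnit t = -1) ∨ (-1 ≤ t ∧ t ≤ 1 ∧ clampUnit t = t) ∨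
      (1 ≤ t ∧ clampUnit t = 1) := by
  unfold clampUnit
  rcases le_total t (-1) with h | h
  · left
    exact ⟨h, by rw [min_eq_right (by linarith), max_eq_left h]⟩
  · rcases le_total t 1 with h' | h'
    · right; left
      exact ⟨h, h', by rw [min_eq_right h', max_eq_right h]⟩
    · right; right
      exact ⟨h', by rw [min_eq_left h', max_eq_right (by norm_num)]⟩

lemma clampUnit_mono : Monotone clampUnit := fun _ _ h =>
  max_le_max le_rfl (min_le_min le_rfl h)

lemma neg_one_le_clampUnit (t : ℝ) : -1 ≤ clampUnit t := le_max_left _ _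

lemma clampUnit_le_one (t : ℝ) : clampUnit t ≤ 1 := max_le (by norm_num) (min_le_left _ _)

lemma clampUnit_sq_of_one_le_abs {t : ℝ} (h : 1 ≤ |t|) : clampUnit t ^ 2 = 1 := by
  rcases clampUnit_cases t with ⟨_, e⟩ | ⟨h1, h2, e⟩ | ⟨_, e⟩
  · rw [e]; norm_num
  · rw [e, ← sq_abs, le_antisymm (abs_le.2 ⟨h1, h2⟩) h]; norm_num
  · rw [e]; norm_num

@[fun_prop]
lemma continuous_clampUnit : Continuous clampUnit := by
  unfold clampUnit; fun_prop

@[fun_prop]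
lemma continuous_huber : Continuous huber := by
  unfold huber; fun_prop

lemma abs_sub_half_le_huber (t : ℝ) : |t| - 1 / 2 ≤ huber t := by
  unfold huber
  rcases clampUnit_cases t with ⟨h, e⟩ | ⟨h1, h2, e⟩ | ⟨h, e⟩ <;> rw [e]
  · rw [abs_of_nonpos (by linarith)]; linarith
  · rw [← sq_abs]
    nlinarith [sq_nonneg (|t| - 1), sq_abs t]
  · rw [abs_of_nonneg (by linarith)]; linarith

lemma huber_nonneg (t : ℝ) : 0 ≤ huber t := by
  unfold huber
  rcases clampUnit_cases t with ⟨h, e⟩ | ⟨h1, h2, e⟩ | ⟨h, e⟩ <;> rw [e] <;> nlinarith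

lemma huber_add_le (t s : ℝ) : huber (t + s) ≤ huber t + clampUnit t * s + s ^ 2 / 2 := by
  have hproj : (t - clampUnit t) * (clampUnit (t + s) - clampUnit t) ≤ 0 := by
    have h1 := neg_one_le_clampUnit (t + s)
    have h2 := clampUnit_le_one (t + s)
    rcases clampUnit_cases t with ⟨h, e⟩ | ⟨_, _, e⟩ | ⟨h, e⟩ <;> rw [e] <;> nlinarith
  unfold huber
  nlinarith [sq_nonneg (clampUnit (t + s) - clampUnit t - s)]

/-- The total Huber loss attains its minimum over monotone functions on the cube. -/
lemma exists_monotoneCube_huber_min {d : ℕ} (f : (Fin d → Bool) → ℝ) :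
    ∃ g, MonotoneCube g ∧ ∀ g', MonotoneCube g' →
      ∑ x, huber (f x - g x) ≤ ∑ x, huber (f x - g' x) := by
  set F : ((Fin d → Bool) → ℝ) → ℝ := fun g => ∑ x, huber (f x - g x) with hF
  have hFc : Continuous F := by fun_prop
  set K : Set ((Fin d → Bool) → ℝ) := {g | MonotoneCube g ∧ F g ≤ F 0} with hK
  have hclosed : IsClosed K := by
    refine IsClosed.inter (s₁ := {g | MonotoneCube g}) ?_ (isClosed_le hFc continuous_const)
    simp only [MonotoneCube, Set.ofPred_forall]
    exact isClosed_iInter fun x => isClosed_iInter fun y => isClosed_iInter fun _ =>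
      isClosed_le (continuous_apply x) (continuous_apply y)
  have hsub : K ⊆ Set.univ.pi fun x => Metric.closedBall (f x) (F 0 + 1 / 2) := by
    rintro g ⟨-, hg⟩ x -
    have h1 : huber (f x - g x) ≤ F g :=
      Finset.single_le_sum (f := fun x => huber (f x - g x))
        (fun y _ => huber_nonneg _) (Finset.mem_univ x)
    have h2 := abs_sub_half_le_huber (f x - g x)
    rw [Metric.mem_closedBall, Real.dist_eq, abs_sub_comm]
    linarith
  have hcomp : IsCompact K :=
    (isCompact_univ_pi fun x => isCompact_closedBall _ _).of_isClosed_subset hclosed hsub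
  have h0 : (0 : (Fin d → Bool) → ℝ) ∈ K := ⟨fun _ _ _ => le_rfl, le_rfl⟩
  obtain ⟨g, hgK, hmin⟩ := hcomp.exists_isMinOn ⟨0, h0⟩ hFc.continuousOn
  refine ⟨g, hgK.1, fun g' hg' => ?_⟩
  by_cases h : F g' ≤ F 0
  · exact hmin ⟨hg', h⟩
  · exact (hmin h0).trans (not_le.1 h).le

open Filter Topology in
/-- First-order optimality condition at a Huber minimizer. -/
lemma sum_clampUnit_mul_nonneg {d : ℕ} {f g k : (Fin d → Bool) → ℝ} (hg : MonotoneCube g)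
    (hmin : ∀ g', MonotoneCube g' → ∑ x, huber (f x - g x) ≤ ∑ x, huber (f x - g' x))
    (hk : ∀ x y, x ≤ y → g x = g y → k y ≤ k x) :
    0 ≤ ∑ x, clampUnit (f x - g x) * k x := by
  have hlim : Tendsto (fun η : ℝ => ∑ x, clampUnit (f x - g x) * k x + η * ∑ x, k x ^ 2 / 2)
      (𝓝[>] 0) (𝓝 (∑ x, clampUnit (f x - g x) * k x)) :=
    (Continuous.tendsto' (by fun_prop) _ _ (by simp)).mono_left nhdsWithin_le_nhds
  refine ge_of_tendsto hlim ?_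
  filter_upwards [hg.eventually_sub_mul hk, self_mem_nhdsWithin] with η hη hpos
  have hpos : 0 < η := hpos
  have hle : ∑ x, huber (f x - (g x - η * k x)) ≤ ∑ x, huber (f x - g x) +
      η * (∑ x, clampUnit (f x - g x) * k x + η * ∑ x, k x ^ 2 / 2) := by
    rw [Finset.mul_sum, ← Finset.sum_add_distrib, Finset.mul_sum, ← Finset.sum_add_distrib]
    refine Finset.sum_le_sum fun x _ => ?_
    have := huber_add_le (f x - g x) (η * k x)
    rw [show f x - (g x - η * k x) = f x - g x + η * k x by ring]
    linarith
  have := hmin _ hη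
  exact nonneg_of_mul_nonneg_right (by linarith) hpos

open Classical in
/-- The contribution of direction `i` to the signed degree of `x` in the graph of cube edges on
which `g` is constant: `1` for an upward edge, `-1` for a downward one. -/
noncomputable def signedTight {d : ℕ} (g : (Fin d → Bool) → ℝ) (x : Fin d → Bool) (i : Fin d) :
    ℝ :=
  if g (Function.update x i false) = g (Function.update x i true) then
    (if x i then -1 else 1) else 0

lemma MonotoneCube.signedTight_le {d : ℕ} {g : (Fin d → Bool) → ℝ} (hg : MonotoneCube g)
    {x y : Fin d → Bool} (hxy : x ≤ y) (heq : g x = g y) (i : Fin d) :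
    signedTight g y i + (if x i = y i then 0 else 2) ≤ signedTight g x i := by
  have hb : ∀ b, g (Function.update x i b) ≤ g (Function.update y i b) := fun b =>
    hg _ _ (update_le_update_iff.2 ⟨le_rfl, fun j _ => hxy j⟩)
  have hx : g (Function.update x i false) ≤ g (Function.update x i true) :=
    hg _ _ (update_le_update_iff.2 ⟨Bool.false_le _, fun j _ => le_rfl⟩)
  have hy : g (Function.update y i false) ≤ g (Function.update y i true) :=
    hg _ _ (update_le_update_iff.2 ⟨Bool.false_le _, fun j _ => le_rfl⟩)
  have ex : g (Function.update x i (x i)) = g x := by rw [Function.update_eq_self]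
  have ey : g (Function.update y i (y i)) = g y := by rw [Function.update_eq_self]
  have hi := hxy i
  have hf := hb false
  have ht := hb true
  unfold signedTight
  cases hxi : x i <;> cases hyi : y i <;> rw [hxi] at ex hi <;> rw [hyi] at ey hi
  · by_cases h : g (Function.update y i false) = g (Function.update y i true)
    · have : g (Function.update x i false) = g (Function.update x i true) := by linarith
      simp [h, this]
    · simp only [h, if_false]
      split_ifs <;> norm_num at *
  · have h1 : g (Function.update x i false) = g (Function.update x i true) := by linarith
    have h2 : g (Function.update y i false) = g (Function.update y i true) := by linarith
    simp only [h1, h2]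
    norm_num
  · exact absurd hi (by simp)
  · by_cases h : g (Function.update x i false) = g (Function.update x i true)
    · have : g (Function.update y i false) = g (Function.update y i true) := by linarith
      simp [h, this]
    · simp only [h, if_false]
      split_ifs <;> norm_num at *

/-- Along a level set of a monotone function the signed degree drops by at least two. -/
lemma MonotoneCube.sum_signedTight_add_two_le {d : ℕ} {g : (Fin d → Bool) → ℝ}
    (hg : MonotoneCube g) {x y : Fin d → Bool} (hxy : x ≤ y) (hne : x ≠ y) (heq : g x = g y) :
    ∑ i, signedTight g y i + 2 ≤ ∑ i, signedTight g x i := by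
  obtain ⟨i, hi⟩ := Function.ne_iff.1 hne
  calc ∑ i, signedTight g y i + 2
      ≤ ∑ i, signedTight g y i + ∑ i, (if x i = y i then (0 : ℝ) else 2) := by
        gcongr
        calc (2 : ℝ) = if x i = y i then (0 : ℝ) else 2 := by rw [if_neg hi]
          _ ≤ _ := Finset.single_le_sum (f := fun i => if x i = y i then (0 : ℝ) else 2)
            (fun j _ => by split_ifs <;> norm_num) (Finset.mem_univ i)
    _ ≤ ∑ i, signedTight g x i := by
        rw [← Finset.sum_add_distrib]
        exact Finset.sum_le_sum fun i _ => hg.signedTight_le hxy heq i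

open Classical in
lemma sum_violations_le_totViol {d : ℕ} (f : (Fin d → Bool) → ℝ) :
    ∑ i, ∑ x, (if x i = false ∧ f (Function.update x i true) < f x then (1 : ℝ) else 0) ≤
      totViol d f := by
  rw [← Finset.sum_product' (f := fun i x =>
    if x i = false ∧ f (Function.update x i true) < f x then (1 : ℝ) else 0), Finset.sum_boole]
  unfold totViol
  rw [Nat.card_eq_fintype_card, Fintype.card_subtype]
  norm_cast
  refine Finset.card_le_card_of_injOn (fun p => (p.2, Function.update p.2 p.1 true)) ?_ ?_
  · rintro ⟨i, x⟩ h
    simp only [Finset.univ_product_univ, Finset.coe_filter, Finset.mem_univ, true_and,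
      Set.mem_ofPred_eq] at h ⊢
    exact ⟨⟨i, h.1, by simp, fun j hj => by simp [hj]⟩, h.2⟩
  · rintro ⟨i, x⟩ h ⟨j, y⟩ h' e
    simp only [Finset.univ_product_univ, Finset.coe_filter, Finset.mem_univ, true_and,
      Set.mem_ofPred_eq] at h h'
    simp only [Prod.mk.injEq] at e ⊢
    obtain ⟨rfl, e⟩ := e
    refine ⟨?_, rfl⟩
    by_contra hne
    have := congrFun e i
    simp [Function.update_of_ne hne, h.1] at this

/-- Pairing `σ` with the signed degree of `g` counts only violated edges, if `σ` takes values in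
`[-1, 1]` and does not decrease along non-violated edges on which `g` is constant. -/
lemma sum_mul_signedTight_le {d : ℕ} {f g σ : (Fin d → Bool) → ℝ} (hl : ∀ x, -1 ≤ σ x)
    (hu : ∀ x, σ x ≤ 1) (hσ : ∀ x y, f x ≤ f y → g x = g y → σ x ≤ σ y) :
    ∑ x, σ x * ∑ i, signedTight g x i ≤ 2 * totViol d f := by
  classical
  have hdir : ∀ i : Fin d, ∑ x, σ x * signedTight g x i ≤ 2 * ∑ x,
      (if x i = false ∧ f (Function.update x i true) < f x then (1 : ℝ) else 0) := by
    intro i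
    have hinv : Function.Involutive fun x : Fin d → Bool => Function.update x i (!x i) := by
      intro x; simp
    have hs : ∀ F : (Fin d → Bool) → ℝ, ∑ x, F (Function.update x i (!x i)) = ∑ x, F x :=
      fun F => Equiv.sum_comp hinv.toPerm F
    have hpair : ∑ x, (σ x * signedTight g x i +
          σ (Function.update x i (!x i)) * signedTight g (Function.update x i (!x i)) i) ≤
        ∑ x, (2 * (if x i = false ∧ f (Function.update x i true) < f x then (1 : ℝ) else 0) +
          2 * (if Function.update x i (!x i) i = false ∧
            f (Function.update (Function.update x i (!x i)) i true) <
              f (Function.update x i (!x i)) then (1 : ℝ) else 0)) := by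
      refine Finset.sum_le_sum fun x _ => ?_
      have ex : Function.update x i (x i) = x := Function.update_eq_self _ _
      have l1 := hl x
      have u1 := hu x
      have l2 := hl (Function.update x i (!x i))
      have u2 := hu (Function.update x i (!x i))
      unfold signedTight
      cases hxi : x i <;> rw [hxi] at ex l2 u2 <;>
        simp only [Bool.not_false, Bool.not_true, Function.update_idem, Function.update_self, ex,
          hxi] at *
      · by_cases hgt : g x = g (Function.update x i true)
        · by_cases hft : f (Function.update x i true) < f x
          · simp [hgt, hft]; linarith
          · have := hσ _ _ (not_lt.1 hft) hgt
            simp [hgt, hft]; linarith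
        · simp only [hgt]; simp; split_ifs <;> norm_num
      · by_cases hgt : g (Function.update x i false) = g x
        · by_cases hft : f x < f (Function.update x i false)
          · simp [hgt, hft]; linarith
          · have := hσ _ _ (not_lt.1 hft) hgt
            simp [hgt, hft]; linarith
        · simp only [hgt]; simp; split_ifs <;> norm_num
    rw [Finset.sum_add_distrib, Finset.sum_add_distrib,
      hs (fun x => σ x * signedTight g x i), ← Finset.mul_sum, ← Finset.mul_sum,
      hs (fun x => if x i = false ∧ f (Function.update x i true) < f x then (1 : ℝ) else 0)]
      at hpair
    linarith
  calc ∑ x, σ x * ∑ i, signedTight g x i = ∑ i, ∑ x, σ x * signedTight g x i := by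
        simp_rw [Finset.mul_sum]; exact Finset.sum_comm
    _ ≤ ∑ i, 2 * ∑ x,
        (if x i = false ∧ f (Function.update x i true) < f x then (1 : ℝ) else 0) :=
      Finset.sum_le_sum fun i _ => hdir i
    _ ≤ 2 * totViol d f := by
      rw [← Finset.mul_sum]
      have := sum_violations_le_totViol f
      linarith

/-- A function that is monotone on a subset of the cube agrees there with a monotone function. -/
lemma exists_monotoneCube_eqOn {d : ℕ} (f : (Fin d → Bool) → ℝ) (S : Set (Fin d → Bool))
    (hS : ∀ x ∈ S, ∀ y ∈ S, x ≤ y → f x ≤ f y) :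
    ∃ g, MonotoneCube g ∧ ∀ x ∈ S, f x = g x := by
  classical
  obtain ⟨z, hz⟩ := Finite.exists_min f
  have hne : (Finset.univ : Finset (Fin d → Bool)).Nonempty := Finset.univ_nonempty
  refine ⟨fun x => Finset.univ.sup' hne fun y => if y ∈ S ∧ y ≤ x then f y else f z, ?_, ?_⟩
  · intro x x' hx
    refine Finset.sup'_mono_fun fun y _ => ?_
    by_cases h : y ∈ S ∧ y ≤ x
    · rw [if_pos h, if_pos ⟨h.1, h.2.trans hx⟩]
    · rw [if_neg h]
      split_ifs
      exacts [hz y, le_rfl]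
  · intro x hx
    apply le_antisymm
    · refine Finset.le_sup'_of_le _ (Finset.mem_univ x) ?_
      rw [if_pos ⟨hx, le_rfl⟩]
    · refine Finset.sup'_le _ _ fun y _ => ?_
      split_ifs with h
      exacts [hS y h.1 x hx h.2, hz x]

open Filter Topology in
lemma exists_pos_gap {α : Type*} [Finite α] (f : α → ℝ) :
    ∃ δ > 0, ∀ x y, f y < f x → f y + 2 * δ ≤ f x := by
  have key : ∀ᶠ δ in 𝓝[>] (0 : ℝ), ∀ x y, f y < f x → f y + 2 * δ ≤ f x := by
    refine eventually_all.2 fun x => eventually_all.2 fun y => ?_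
    by_cases h : f y < f x
    · have hl : Tendsto (fun δ : ℝ => f y + 2 * δ) (𝓝 0) (𝓝 (f y)) :=
        Continuous.tendsto' (by fun_prop) _ _ (by simp)
      filter_upwards [nhdsWithin_le_nhds (hl.eventually_lt_const h)] with δ hδ _ using hδ.le
    · exact Eventually.of_forall fun _ h' => absurd h' h
  obtain ⟨δ, h1, h2⟩ := (key.and self_mem_nhdsWithin).exists
  exact ⟨δ, h2, h1⟩

/-- Some monotone function differs from `f` in at most twice as many points as `f` has violated
edges. -/
lemma exists_monotoneCube_card_ne_le {d : ℕ} (f : (Fin d → Bool) → ℝ) :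
    ∃ g, MonotoneCube g ∧ Nat.card {x : Fin d → Bool // f x ≠ g x} ≤ 2 * totViol d f := by
  classical
  obtain ⟨δ, hδ, hgap⟩ := exists_pos_gap f
  obtain ⟨g, hg, hmin⟩ := exists_monotoneCube_huber_min fun x => f x / δ
  set σ : (Fin d → Bool) → ℝ := fun x => clampUnit (f x / δ - g x) with hσ
  have hopt : 0 ≤ ∑ x, σ x * (∑ i, signedTight g x i - σ x) := by
    refine sum_clampUnit_mul_nonneg (k := fun x => ∑ i, signedTight g x i - σ x) hg hmin ?_
    intro x y hxy heq
    rcases eq_or_ne x y with rfl | hne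
    · exact le_rfl
    · have h1 := hg.sum_signedTight_add_two_le hxy hne heq
      have h2 : σ x ≤ 1 := clampUnit_le_one _
      have h3 : -1 ≤ σ y := neg_one_le_clampUnit _
      linarith
  have hviol : ∑ x, σ x * ∑ i, signedTight g x i ≤ 2 * totViol d f := by
    refine sum_mul_signedTight_le (fun _ => neg_one_le_clampUnit _) (fun _ => clampUnit_le_one _) ?_
    intro x y hf hgeq
    refine clampUnit_mono ?_
    rw [hgeq]
    gcongr
  obtain ⟨g', hg', heq⟩ := exists_monotoneCube_eqOn f {x | |f x / δ - g x| < 1} (by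
    intro x hx y hy hxy
    by_contra! hlt
    have h1 := hgap x y hlt
    have h2 : f y / δ + 2 ≤ f x / δ := by
      rw [div_add' _ _ _ hδ.ne']
      gcongr
    have h3 := hg x y hxy
    have h4 := (abs_lt.1 (show |f x / δ - g x| < 1 from hx)).2
    have h5 := (abs_lt.1 (show |f y / δ - g y| < 1 from hy)).1
    linarith)
  refine ⟨g', hg', ?_⟩
  have hcard : (Nat.card {x : Fin d → Bool // f x ≠ g' x} : ℝ) ≤ ∑ x, σ x ^ 2 := by
    rw [Nat.card_eq_fintype_card, Fintype.card_subtype, ← Finset.sum_boole]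
    refine Finset.sum_le_sum fun x _ => ?_
    split_ifs with h
    · refine (clampUnit_sq_of_one_le_abs ?_).ge
      by_contra! hlt
      exact h (heq x hlt)
    · positivity
  have hsplit : ∑ x, σ x * (∑ i, signedTight g x i - σ x) =
      ∑ x, σ x * ∑ i, signedTight g x i - ∑ x, σ x ^ 2 := by
    rw [← Finset.sum_sub_distrib]
    exact Finset.sum_congr rfl fun x _ => by ring
  have : (Nat.card {x : Fin d → Bool // f x ≠ g' x} : ℝ) ≤ 2 * totViol d f := by linarith
  exact_mod_cast this

/-- Every real-valued function on the hypercube violates at least `ε(f) · 2^(d-1)` edges. -/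
theorem violated_edges_lower_bound (d : ℕ) (hd : 1 ≤ d) (f : (Fin d → Bool) → ℝ) :
    (totViol d f : ℝ) ≥ distMono d f * 2 ^ (d - 1) := by
  obtain ⟨g, hg, hcard⟩ := exists_monotoneCube_card_ne_le f
  have hinf : sInf {n : ℕ | ∃ g : (Fin d → Bool) → ℝ, MonotoneCube g ∧
      n = Nat.card {x : Fin d → Bool // f x ≠ g x}} ≤ 2 * totViol d f :=
    le_trans (Nat.sInf_le (by exact ⟨g, hg, rfl⟩)) hcard
  have hreal : ((sInf {n : ℕ | ∃ g : (Fin d → Bool) → ℝ, MonotoneCube g ∧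
      n = Nat.card {x : Fin d → Bool // f x ≠ g x}} : ℕ) : ℝ) ≤ 2 * totViol d f := by
    exact_mod_cast hinf
  have hpow : (2 : ℝ) ^ d = 2 * 2 ^ (d - 1) := by
    rw [← pow_succ', Nat.sub_add_cancel hd]
  unfold distMono
  rw [hpow, ge_iff_le, div_mul_eq_mul_div, div_le_iff₀ (by positivity)]
  have hpos : (0 : ℝ) < 2 ^ (d - 1) := by positivity
  nlinarith
end
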